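/- Consider the linear time-varying plant ẋ(t) = A(t)x(t) + B(t)u(t) + G(t)w(t), x(t₀) = 0, y(t) = C(t)x(t) on Ω = [t₀, t₀+T], with exogenous disturbance w ∈ W₂. There exists a dynamic output feedback controller ẋ_c(t) = A_K(t)x_c(t) + B_K(t)y(t), u(t) = C_K(t)x_c(t) + D_K(t)y(t), with x_c of the same dimension n as x, such that the closed-loop system (with state (x, x_c), closed-loop dynamics matrix [[A + B·D_K·C, B·C_K], [B_K·C, A_K]], input matrix [Gᵀ, 0]ᵀ, and output y = C·x) is IO-FTS with respect to (W₂, Q(·), Ω), if and only if there exist two continuously differentiable symmetric matrix-valued functions S(·), T(·) on Ω, a nonsingular matrix-valued function N(·), and matrix-valued functions Â_K(·), B̂_K(·), Ĉ_K(·), D_K(·) such that for all t ∈ Ω: (a) the block matrix [[Θ₁₁(t), Θ₁₂(t), 0], [Θ₁₂(t)ᵀ, Θ₂₂(t), T(t)G(t)], [0, G(t)ᵀT(t), −R(t)]] is negative definite, where Θ₁₁ = −Ṡ + AS + SAᵀ + BĈ_K + Ĉ_KᵀBᵀ + GR⁻¹Gᵀ, Θ₁₂ = A + Â_Kᵀ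 + BD_KC + GR⁻¹GᵀT, Θ₂₂ = Ṫ + TA + AᵀT + B̂_KC + CᵀB̂_Kᵀ; and (b) the block matrix [[Ξ₁₁(t), Ξ₁₂(t), 0], [Ξ₁₂(t)ᵀ, S(t), S(t)C(t)ᵀ], [0, C(t)S(t), Q(t)⁻¹]] is positive definite, where Ξ₁₁ = T − CᵀQC and Ξ₁₂ = I − CᵀQCS. -/

import Mathlib

open MeasureTheory Matrix Set


/-- Entrywise derivative of a matrix function within an interval. -/
def MD {ι κ : Type*} (F F' : ℝ → Matrix ι κ ℝ) (a b : ℝ) : Prop :=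
  ∀ t ∈ Icc a b, ∀ i j, HasDerivWithinAt (fun s => F s i j) (F' t i j) (Icc a b) t

/-- Clamping to an interval. -/
noncomputable def clampI (a b t : ℝ) : ℝ := max a (min t b)

theorem clampI_mem {a b : ℝ} (hab : a ≤ b) (t : ℝ) : clampI a b t ∈ Icc a b := by
  unfold clampI; exact ⟨le_max_left _ _, max_le hab (min_le_right _ _)⟩

theorem clampI_eq {a b t : ℝ} (ht : t ∈ Icc a b) : clampI a b t = t := by
  unfold clampI; rw [min_eq_left ht.2, max_eq_right ht.1]

theorem clampI_cont (a b : ℝ) : Continuous (clampI a b) := by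
  unfold clampI; fun_prop

theorem cont_clamp {ι κ : Type*} {a b : ℝ} (hab : a ≤ b) {F : ℝ → Matrix ι κ ℝ}
    (hF : ∀ i j, ContinuousOn (fun t => F t i j) (Icc a b)) :
    Continuous (fun t => F (clampI a b t)) := by
  refine continuous_matrix fun i j => ?_
  exact (hF i j).comp_continuous (clampI_cont a b) (clampI_mem hab)

theorem MD.congr {ι κ : Type*} {F F' H H' : ℝ → Matrix ι κ ℝ} {a b : ℝ} (h : MD F F' a b)
    (h1 : ∀ t ∈ Icc a b, H t = F t) (h2 : ∀ t ∈ Icc a b, H' t = F' t) : MD H H' a b := by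
  intro t ht i j
  rw [h2 t ht]
  exact (h t ht i j).congr (fun s hs => by rw [h1 s hs]) (by rw [h1 t ht])

theorem MD.mul {ι κ l : Type*} [Fintype κ] {F F' : ℝ → Matrix ι κ ℝ} {H H' : ℝ → Matrix κ l ℝ}
    {a b : ℝ} (h : MD F F' a b) (k : MD H H' a b) :
    MD (fun t => F t * H t) (fun t => F' t * H t + F t * H' t) a b := by
  intro t ht i j
  simp only [Matrix.mul_apply, Matrix.add_apply, ← Finset.sum_add_distrib]
  exact HasDerivWithinAt.fun_sum fun u _ => (h t ht i u).fun_mul (k t ht u j)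

theorem MD.add {ι κ : Type*} {F F' H H' : ℝ → Matrix ι κ ℝ}
    {a b : ℝ} (h : MD F F' a b) (k : MD H H' a b) :
    MD (fun t => F t + H t) (fun t => F' t + H' t) a b := by
  intro t ht i j
  exact (h t ht i j).fun_add (k t ht i j)

theorem MD.sub {ι κ : Type*} {F F' H H' : ℝ → Matrix ι κ ℝ}
    {a b : ℝ} (h : MD F F' a b) (k : MD H H' a b) :
    MD (fun t => F t - H t) (fun t => F' t - H' t) a b := by
  intro t ht i j
  exact (h t ht i j).fun_sub (k t ht i j)

theorem MD.transpose {ι κ : Type*} {F F' : ℝ → Matrix ι κ ℝ}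
    {a b : ℝ} (h : MD F F' a b) :
    MD (fun t => (F t)ᵀ) (fun t => (F' t)ᵀ) a b := fun t ht i j => h t ht j i

theorem MD.const {ι κ : Type*} (M : Matrix ι κ ℝ) (a b : ℝ) :
    MD (fun _ => M) (fun _ => 0) a b := fun t _ i j => hasDerivWithinAt_const t _ (M i j)

theorem MD.contOn {ι κ : Type*} {F F' : ℝ → Matrix ι κ ℝ} {a b : ℝ} (h : MD F F' a b) :
    ∀ i j, ContinuousOn (fun t => F t i j) (Icc a b) :=
  fun i j t ht => (h t ht i j).continuousWithinAt

theorem const_of_deriv_zero {a b : ℝ} {f : ℝ → ℝ}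
    (h : ∀ t ∈ Icc a b, HasDerivWithinAt f 0 (Icc a b) t) :
    ∀ t ∈ Icc a b, f t = f a := by
  apply constant_of_has_deriv_right_zero
  · exact fun t ht => (h t ht).continuousWithinAt
  · intro t ht
    exact ((h t ⟨ht.1, ht.2.le⟩).mono_of_mem_nhdsWithin (Icc_mem_nhdsGE_of_mem ht))

theorem diff_det {ι : Type*} [Fintype ι] [DecidableEq ι] {F : ℝ → Matrix ι ι ℝ} {s : Set ℝ} {t : ℝ}
    (h : ∀ i j, DifferentiableWithinAt ℝ (fun x => F x i j) s t) :
    DifferentiableWithinAt ℝ (fun x => (F x).det) s t := by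
  simp only [Matrix.det_apply']
  refine DifferentiableWithinAt.fun_sum fun σ _ => ?_
  refine DifferentiableWithinAt.fun_mul (differentiableWithinAt_const _) ?_
  exact DifferentiableWithinAt.fun_finsetProd fun i _ => h _ _

theorem MD.inv {ι : Type*} [Fintype ι] [DecidableEq ι] {F F' : ℝ → Matrix ι ι ℝ} {a b : ℝ}
    (hab : a < b) (h : MD F F' a b) (hu : ∀ t ∈ Icc a b, IsUnit (F t)) :
    MD (fun t => (F t)⁻¹) (fun t => -((F t)⁻¹ * F' t * (F t)⁻¹)) a b := by
  have hd : ∀ t ∈ Icc a b, ∀ i j, DifferentiableWithinAt ℝ (fun x => (F x)⁻¹ i j) (Icc a b) t := by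
    intro t ht i j
    simp only [Matrix.inv_def, Ring.inverse_eq_inv', Matrix.smul_apply, smul_eq_mul,
      Matrix.adjugate_apply]
    refine DifferentiableWithinAt.fun_mul (DifferentiableWithinAt.fun_inv
      (diff_det fun i j => (h t ht i j).differentiableWithinAt) ?_) (diff_det fun u v => ?_)
    · exact ((Matrix.isUnit_iff_isUnit_det _).1 (hu t ht)).ne_zero
    · simp only [Matrix.updateRow_apply]
      split_ifs
      · exact differentiableWithinAt_const _
      · exact (h t ht u v).differentiableWithinAt
  have h2 : MD (fun t => (F t)⁻¹)
      (fun t => Matrix.of fun i j => derivWithin (fun x => (F x)⁻¹ i j) (Icc a b) t) a b :=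
    fun t ht i j => (hd t ht i j).hasDerivWithinAt
  have h3 := h.mul h2
  intro t ht i j
  have h4 : F' t * (F t)⁻¹ + F t *
      (Matrix.of fun i j => derivWithin (fun x => (F x)⁻¹ i j) (Icc a b) t) = 0 := by
    ext u v
    have e1 := h3 t ht u v
    have e2 : HasDerivWithinAt (fun s => (F s * (F s)⁻¹) u v) 0 (Icc a b) t := by
      refine (hasDerivWithinAt_const t _ ((1 : Matrix ι ι ℝ) u v)).congr_of_mem (fun s hs => ?_) ht
      rw [Matrix.mul_nonsing_inv _ ((Matrix.isUnit_iff_isUnit_det _).1 (hu s hs))]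
    exact (uniqueDiffOn_Icc hab t ht).eq_deriv _ e1 e2
  have h5 := congrArg (fun X => (F t)⁻¹ * X) h4
  simp only [Matrix.mul_add, Matrix.mul_zero] at h5
  rw [Matrix.nonsing_inv_mul_cancel_left _ _ ((Matrix.isUnit_iff_isUnit_det _).1 (hu t ht))] at h5
  have h6 := eq_neg_of_add_eq_zero_right h5
  have h7 := h2 t ht i j
  beta_reduce at h7
  rw [h6, ← Matrix.mul_assoc] at h7
  exact h7

theorem cont_inv {ι X : Type*} [Fintype ι] [DecidableEq ι] [TopologicalSpace X]
    {F : X → Matrix ι ι ℝ} (h : Continuous F) (hu : ∀ t, IsUnit (F t)) :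
    Continuous (fun t => (F t)⁻¹) := by
  simp only [Matrix.inv_def, Ring.inverse_eq_inv']
  refine Continuous.smul (Continuous.inv₀ h.matrix_det fun t => ?_) h.matrix_adjugate
  exact ((Matrix.isUnit_iff_isUnit_det _).1 (hu t)).ne_zero

theorem linODE {ι : Type*} [Fintype ι] {a b : ℝ} (hab : a ≤ b)
    (A : ℝ → Matrix ι ι ℝ) (hA : Continuous A) (x0 : ι → ℝ) :
    ∃ x : ℝ → ι → ℝ, x a = x0 ∧ ∀ t ∈ Icc a b, HasDerivWithinAt x (A t *ᵥ x t) (Icc a b) t := by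
  -- bound on A
  obtain ⟨K, hK⟩ : ∃ K : ℝ, 0 ≤ K ∧ ∀ t ∈ Icc a b, ∀ v : ι → ℝ, ‖A t *ᵥ v‖ ≤ K * ‖v‖ := by
    have h1 : ∀ i j, ∃ k : ℝ, ∀ t ∈ Icc a b, ‖A t i j‖ ≤ k := fun i j =>
      isCompact_Icc.exists_bound_of_continuousOn (hA.matrix_elem i j).continuousOn
    choose k hk using h1
    have hk0 : ∀ i j, 0 ≤ k i j := fun i j => (norm_nonneg _).trans (hk i j a ⟨le_rfl, hab⟩)
    refine ⟨∑ i, ∑ j, k i j, Finset.sum_nonneg fun i _ => Finset.sum_nonneg fun j _ => hk0 i j,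
      fun t ht v => ?_⟩
    have hs : 0 ≤ ∑ i, ∑ j, k i j :=
      Finset.sum_nonneg fun i _ => Finset.sum_nonneg fun j _ => hk0 i j
    refine (pi_norm_le_iff_of_nonneg (by positivity)).2 fun i => ?_
    calc ‖(A t *ᵥ v) i‖ ≤ ∑ j, ‖A t i j * v j‖ := norm_sum_le _ _
      _ ≤ ∑ j, k i j * ‖v‖ := by
          refine Finset.sum_le_sum fun j _ => ?_
          rw [norm_mul]
          exact mul_le_mul (hk i j t ht) (norm_le_pi_norm v j) (norm_nonneg _) (hk0 i j)
      _ = (∑ j, k i j) * ‖v‖ := by rw [Finset.sum_mul]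
      _ ≤ _ := by
          refine mul_le_mul_of_nonneg_right ?_ (norm_nonneg _)
          exact Finset.single_le_sum (f := fun i => ∑ j, k i j)
            (fun i _ => Finset.sum_nonneg fun j _ => hk0 i j) (Finset.mem_univ i)
  obtain ⟨hK0, hK⟩ := hK
  set M : ℝ := ‖x0‖ * Real.exp (K * (b - a)) with hM
  have hM0 : 0 ≤ M := by positivity
  let p : (ι → ℝ) → ι → ℝ := fun v i => max (-M) (min (v i) M)
  have hp1 : ∀ u v, ‖p u - p v‖ ≤ ‖u - v‖ := by
    intro u v
    refine (pi_norm_le_iff_of_nonneg (norm_nonneg _)).2 fun i => ?_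
    refine le_trans ?_ (norm_le_pi_norm (u - v) i)
    simp only [p, Pi.sub_apply, Real.norm_eq_abs]
    refine (abs_max_sub_max_le_max _ _ _ _).trans ?_
    simp only [sub_self, abs_zero]
    refine max_le (abs_nonneg _) ((abs_min_sub_min_le_max _ _ _ _).trans ?_)
    simp
  have hp0 : p 0 = 0 := by
    ext i; simp [p, hM0]
  have hp2 : ∀ u, ‖p u‖ ≤ ‖u‖ := fun u => by simpa [hp0] using hp1 u 0
  have hp3 : ∀ u, ‖p u‖ ≤ M := fun u => by
    refine (pi_norm_le_iff_of_nonneg hM0).2 fun i => ?_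
    rw [Real.norm_eq_abs, abs_le]
    exact ⟨le_max_left _ _, max_le (by linarith) (min_le_right _ _)⟩
  have hp4 : ∀ u, ‖u‖ ≤ M → p u = u := fun u hu => by
    ext i
    have := (norm_le_pi_norm u i).trans hu
    rw [Real.norm_eq_abs, abs_le] at this
    simp [p, this.1, this.2]
  have PL : IsPicardLindelof (fun t v => A t *ᵥ p v) (⟨a, le_rfl, hab⟩ : Icc a b) x0
      ⟨K * M * (b - a), by have := sub_nonneg.2 hab; positivity⟩ 0 ⟨K * M, by positivity⟩ ⟨K, hK0⟩ := by
    refine ⟨?_, ?_, ?_, ?_⟩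
    · intro t ht
      refine LipschitzOnWith.of_dist_le_mul fun u _ v _ => ?_
      rw [dist_eq_norm, dist_eq_norm, ← Matrix.mulVec_sub]
      exact (hK t ht _).trans (mul_le_mul_of_nonneg_left (hp1 u v) hK0)
    · intro v _
      exact (hA.matrix_mulVec continuous_const).continuousOn
    · intro t ht v _
      exact (hK t ht _).trans (mul_le_mul_of_nonneg_left (hp3 v) hK0)
    · simp only [sub_self, NNReal.coe_zero, sub_zero, max_eq_left (sub_nonneg.2 hab)]
      exact le_rfl
  obtain ⟨x, hx0, hx⟩ := PL.exists_eq_forall_mem_Icc_hasDerivWithinAt₀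
  refine ⟨x, hx0, fun t ht => ?_⟩
  have hb : ∀ t ∈ Icc a b, ‖x t‖ ≤ M := by
    intro t ht
    have := norm_le_gronwallBound_of_norm_deriv_right_le (f := x) (K := K) (ε := 0) (δ := ‖x0‖)
      (a := a) (b := b) (f' := fun t => A t *ᵥ p (x t))
      (fun t ht => (hx t ht).continuousWithinAt)
      (fun t ht => (hx t ⟨ht.1, ht.2.le⟩).mono_of_mem_nhdsWithin (Icc_mem_nhdsGE_of_mem ht))
      (by rw [← hx0])
      (fun t ht => by
        rw [add_zero]
        exact (hK t ⟨ht.1, ht.2.le⟩ _).trans (mul_le_mul_of_nonneg_left (hp2 _) hK0)) t ht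
    rw [gronwallBound_ε0] at this
    refine this.trans ?_
    rw [hM]
    have := ht.2
    gcongr
  have := hx t ht
  simpa only [hp4 _ (hb t ht)] using this

theorem fund {ι : Type*} [Fintype ι] [DecidableEq ι] {a b : ℝ} (hab : a ≤ b)
    (A : ℝ → Matrix ι ι ℝ) (hA : Continuous A) :
    ∃ Φ Ψ : ℝ → Matrix ι ι ℝ, Continuous Φ ∧ Continuous Ψ ∧
      MD Φ (fun t => A t * Φ t) a b ∧ MD Ψ (fun t => -(Ψ t * A t)) a b ∧
      (∀ t ∈ Icc a b, Ψ t * Φ t = 1) ∧ (∀ t ∈ Icc a b, Φ t * Ψ t = 1) := by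
  choose φ hφ0 hφ using fun j : ι => linODE hab A hA (Pi.single j 1)
  choose ψ hψ0 hψ using fun j : ι => linODE hab (fun t => -(A t)ᵀ) hA.matrix_transpose.neg
    (Pi.single j 1)
  have h1 : MD (fun t => Matrix.of fun i j => φ j t i)
      (fun t => A t * Matrix.of fun i j => φ j t i) a b := by
    intro t ht i j
    exact hasDerivWithinAt_pi.1 (hφ j t ht) i
  have h2 : MD (fun t => Matrix.of fun i j => ψ i t j)
      (fun t => -((Matrix.of fun i j => ψ i t j) * A t)) a b := by
    intro t ht i j
    have := hasDerivWithinAt_pi.1 (hψ i t ht) j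
    convert! this using 1
    simp only [Matrix.neg_mulVec, Pi.neg_apply, Matrix.neg_apply, Matrix.mulVec_transpose]
    rfl
  set Φ : ℝ → Matrix ι ι ℝ := (fun t => Matrix.of fun i j => φ j t i) with hΦ
  set Ψ : ℝ → Matrix ι ι ℝ := (fun t => Matrix.of fun i j => ψ i t j) with hΨ
  change MD Φ (fun t => A t * Φ t) a b at h1
  change MD Ψ (fun t => -(Ψ t * A t)) a b at h2
  have ha1 : Φ a = 1 := by
    ext i j; simp [hΦ, hφ0, Pi.single_apply, Matrix.one_apply]
  have ha2 : Ψ a = 1 := by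
    ext i j; simp [hΨ, hψ0, Pi.single_apply, Matrix.one_apply, eq_comm]
  have h3 : ∀ t ∈ Icc a b, Ψ t * Φ t = 1 := by
    intro t ht
    ext i j
    have := const_of_deriv_zero (a := a) (b := b) (f := fun t => (Ψ t * Φ t) i j) (fun t ht => by
      have := (h2.mul h1) t ht i j
      simpa [Matrix.mul_assoc] using this) t ht
    simp only [this, ha1, ha2, one_mul]
  refine ⟨fun t => Φ (clampI a b t), fun t => Ψ (clampI a b t), cont_clamp hab h1.contOn,
    cont_clamp hab h2.contOn, ?_, ?_, ?_, ?_⟩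
  · exact h1.congr (fun t ht => by simp only [clampI_eq ht]) (fun t ht => by simp only [clampI_eq ht])
  · exact h2.congr (fun t ht => by simp only [clampI_eq ht]) (fun t ht => by simp only [clampI_eq ht])
  · intro t ht; simp only [clampI_eq ht, h3 t ht]
  · intro t ht; simp only [clampI_eq ht]; exact mul_eq_one_comm.1 (h3 t ht)


/-- Integral form of a Carathéodory solution started at zero. -/
def Sol {κ : Type*} [Fintype κ] (a b : ℝ) (F : ℝ → κ → ℝ) (x : ℝ → κ → ℝ) : Prop :=
  ∀ t ∈ Icc a b, IntervalIntegrable F volume a t ∧ x t = ∫ τ in a..t, F τ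

theorem Sol.congr {κ : Type*} [Fintype κ] {a b : ℝ} {F H : ℝ → κ → ℝ} {x : ℝ → κ → ℝ}
    (h : Sol a b F x) (hFH : ∀ t ∈ Icc a b, F t = H t) : Sol a b H x := by
  intro t ht
  have hs : ∀ τ ∈ uIcc a t, F τ = H τ := by
    intro τ hτ
    rw [uIcc_of_le ht.1] at hτ
    exact hFH τ ⟨hτ.1, hτ.2.trans ht.2⟩
  refine ⟨(h t ht).1.congr fun τ hτ => hs τ (uIoc_subset_uIcc hτ), ?_⟩
  rw [(h t ht).2]
  exact intervalIntegral.integral_congr hs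

theorem ii_eval {κ : Type*} [Fintype κ] {a t : ℝ} {F : ℝ → κ → ℝ} :
    IntervalIntegrable F volume a t ↔ ∀ i, IntervalIntegrable (fun τ => F τ i) volume a t := by
  simp only [intervalIntegrable_iff, IntegrableOn]
  exact integrable_pi_iff

theorem int_eval {κ : Type*} [Fintype κ] {a t : ℝ} {F : ℝ → κ → ℝ}
    (h : ∀ i, IntervalIntegrable (fun τ => F τ i) volume a t) (i : κ) :
    (∫ τ in a..t, F τ) i = ∫ τ in a..t, F τ i :=
  ((ContinuousLinearMap.proj (R := ℝ) (φ := fun _ : κ => ℝ) i).intervalIntegral_comp_comm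
    (ii_eval.2 h)).symm

theorem sol_iff {κ : Type*} [Fintype κ] {a b : ℝ} {F x : ℝ → κ → ℝ} :
    Sol a b F x ↔ ∀ t ∈ Icc a b, ∀ i, IntervalIntegrable (fun τ => F τ i) volume a t ∧
      x t i = ∫ τ in a..t, F τ i := by
  refine forall₂_congr fun t ht => ⟨fun h i => ?_, fun h => ?_⟩
  · refine ⟨ii_eval.1 h.1 i, ?_⟩
    rw [h.2, int_eval (ii_eval.1 h.1)]
  · refine ⟨ii_eval.2 fun i => (h i).1, ?_⟩
    ext i
    rw [int_eval (fun i => (h i).1), (h i).2]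

theorem ibp {a b : ℝ} (hab : a ≤ b) {f f' F g : ℝ → ℝ}
    (hf' : IntervalIntegrable f' volume a b) (hg : IntervalIntegrable g volume a b)
    (hf : ∀ x ∈ Icc a b, f x = f a + ∫ τ in a..x, f' τ)
    (hF : ∀ x ∈ Icc a b, F x = F a + ∫ τ in a..x, g τ) :
    IntervalIntegrable (fun x => f' x * F x + f x * g x) volume a b ∧
    f b * F b - f a * F a = ∫ x in a..b, (f' x * F x + f x * g x) := by
  have key : ∀ (u u' : ℝ → ℝ), IntervalIntegrable u' volume a b →
      AbsolutelyContinuousOnInterval (fun x => u a + ∫ τ in a..x, u' τ) a b := by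
    intro u u' hu
    have h1 := hu.absolutelyContinuousOnInterval_intervalIntegral (c := a) (by simp)
    have h2 : AbsolutelyContinuousOnInterval (fun _ : ℝ => u a) a b :=
      (contDiff_const.contDiffOn).absolutelyContinuousOnInterval
    exact h2.fun_add h1
  have hf1 := key f f' hf'
  have hF1 := key F g hg
  have hc : ∀ (u u' : ℝ → ℝ), IntervalIntegrable u' volume a b →
      (∀ x ∈ Icc a b, u x = u a + ∫ τ in a..x, u' τ) → ContinuousOn u (uIcc a b) := by
    intro u u' hu h
    refine (key u u' hu).continuousOn.congr ?_
    rw [uIcc_of_le hab]; exact h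
  have d : ∀ (u u' : ℝ → ℝ), IntervalIntegrable u' volume a b →
      ∀ᵐ x, x ∈ uIcc a b → deriv (fun x => u a + ∫ τ in a..x, u' τ) x = u' x := by
    intro u u' hu
    filter_upwards [hu.ae_hasDerivAt_integral] with x hx hx2
    exact ((hx hx2 a (by simp)).const_add _).deriv
  refine ⟨(hf'.mul_continuousOn (hc F g hg hF)).add (hg.continuousOn_mul (hc f f' hf' hf)), ?_⟩
  have h3 := hf1.integral_deriv_mul_eq_sub hF1
  rw [hf b ⟨hab, le_rfl⟩, hF b ⟨hab, le_rfl⟩]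
  simp only [intervalIntegral.integral_same, add_zero] at h3
  rw [← h3]
  apply intervalIntegral.integral_congr_ae
  filter_upwards [d f f' hf', d F g hg] with x h1 h2 hx
  have hx' := uIoc_subset_uIcc hx
  have hx2 : x ∈ Icc a b := by rwa [uIcc_of_le hab] at hx'
  rw [h1 hx', h2 hx', ← hf x hx2, ← hF x hx2]

theorem ftc {a b : ℝ} (hab : a ≤ b) {f f' : ℝ → ℝ} (h' : ContinuousOn f' (Icc a b))
    (h : ∀ t ∈ Icc a b, HasDerivWithinAt f (f' t) (Icc a b) t) :
    ∀ t ∈ Icc a b, IntervalIntegrable f' volume a t ∧ f t = f a + ∫ τ in a..t, f' τ := by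
  intro t ht
  have hi : IntervalIntegrable f' volume a t := by
    apply ContinuousOn.intervalIntegrable
    rw [uIcc_of_le ht.1]
    exact h'.mono (Icc_subset_Icc_right ht.2)
  refine ⟨hi, ?_⟩
  rw [intervalIntegral.integral_eq_sub_of_hasDeriv_right_of_le ht.1 _ _ hi]
  · ring
  · exact fun s hs => ((h s ⟨hs.1, hs.2.trans ht.2⟩).mono (Icc_subset_Icc_right ht.2)).continuousWithinAt
  · intro s hs
    have hs2 : s ∈ Ico a b := ⟨hs.1.le, hs.2.trans_le ht.2⟩
    exact ((h s ⟨hs2.1, hs2.2.le⟩).mono_of_mem_nhdsWithin (Icc_mem_nhdsGE_of_mem hs2)).mono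
      Ioi_subset_Ici_self

theorem cont_dot {ι X : Type*} [Fintype ι] [TopologicalSpace X] {u v : X → ι → ℝ}
    (hu : Continuous u) (hv : Continuous v) : Continuous (fun x => u x ⬝ᵥ v x) :=
  hu.dotProduct hv

theorem Sol.mono {κ : Type*} [Fintype κ] {a b c : ℝ} (hc : c ≤ b) {F x : ℝ → κ → ℝ}
    (h : Sol a b F x) : Sol a c F x := fun t ht => h t ⟨ht.1, ht.2.trans hc⟩

theorem adjoint_formula {κ : Type*} [Fintype κ] [DecidableEq κ] {a b : ℝ}
    {A Ψ : ℝ → Matrix κ κ ℝ} (hA : Continuous A) (hΨ : Continuous Ψ)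
    (hd : MD Ψ (fun t => -(Ψ t * A t)) a b) {g x : ℝ → κ → ℝ}
    (hx : Sol a b (fun τ => A τ *ᵥ x τ + g τ) x) {t : ℝ} (ht : t ∈ Icc a b) (i : κ) :
    IntervalIntegrable (fun τ => (Ψ τ *ᵥ g τ) i) volume a t ∧
    (Ψ t *ᵥ x t) i = ∫ τ in a..t, (Ψ τ *ᵥ g τ) i := by
  have hx' := sol_iff.1 hx
  have hx0 : x a = 0 := by
    have := (hx a ⟨le_rfl, ht.1.trans ht.2⟩).2
    simpa using this
  have hdc : ∀ i j, ContinuousOn (fun t => (-(Ψ t * A t)) i j) (Icc a b) := fun i j =>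
    ((hΨ.matrix_mul hA).neg.matrix_elem i j).continuousOn
  have h := fun j => ibp (a := a) (b := t) ht.1 (f := fun t => Ψ t i j) (F := fun t => x t j)
    (f' := fun t => (-(Ψ t * A t)) i j) (g := fun τ => (A τ *ᵥ x τ + g τ) j)
    (ftc (ht.1.trans ht.2) (hdc i j) (fun s hs => hd s hs i j) t ht).1
    (hx' t ht j).1
    (fun s hs => (ftc (ht.1.trans ht.2) (hdc i j) (fun s hs => hd s hs i j) s
      ⟨hs.1, hs.2.trans ht.2⟩).2)
    (fun s hs => by
      rw [hx0]
      simp only [Pi.zero_apply, zero_add]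
      exact (hx' s ⟨hs.1, hs.2.trans ht.2⟩ j).2)
  have e : (fun τ => (Ψ τ *ᵥ g τ) i) = fun τ => ∑ j, ((-(Ψ τ * A τ)) i j * x τ j +
      Ψ τ i j * (A τ *ᵥ x τ + g τ) j) := by
    funext τ
    rw [Finset.sum_add_distrib]
    change _ = ((-(Ψ τ * A τ)) *ᵥ x τ) i + (Ψ τ *ᵥ (A τ *ᵥ x τ + g τ)) i
    simp [Matrix.mulVec_add, Matrix.neg_mulVec]
  rw [e]
  refine ⟨by simpa only [Finset.sum_fn] using IntervalIntegrable.sum Finset.univ (fun j _ => (h j).1), ?_⟩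
  rw [intervalIntegral.integral_finsetSum (fun j _ => (h j).1)]
  change ∑ j, Ψ t i j * x t j = _
  refine Finset.sum_congr rfl fun j _ => ?_
  rw [← (h j).2, hx0]
  simp

theorem voc {κ : Type*} [Fintype κ] [DecidableEq κ] {a b : ℝ}
    {A Φ Ψ : ℝ → Matrix κ κ ℝ} (hA : Continuous A) (hΦ : Continuous Φ) (hΨ : Continuous Ψ)
    (hd : MD Φ (fun t => A t * Φ t) a b) (h1 : ∀ t ∈ Icc a b, Φ t * Ψ t = 1)
    {g z : ℝ → κ → ℝ}
    (hz : Sol a b (fun τ => Ψ τ *ᵥ g τ) z) :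
    Sol a b (fun τ => A τ *ᵥ (Φ τ *ᵥ z τ) + g τ) (fun t => Φ t *ᵥ z t) := by
  have hab0 : Sol a b (fun τ => A τ *ᵥ (Φ τ *ᵥ z τ) + Φ τ *ᵥ (Ψ τ *ᵥ g τ)) (fun t => Φ t *ᵥ z t) := by
    rw [sol_iff]
    intro t ht i
    have hz' := sol_iff.1 hz
    have hz0 : z a = 0 := by
      have := (hz a ⟨le_rfl, ht.1.trans ht.2⟩).2
      simpa using this
    have hdc : ∀ i j, ContinuousOn (fun t => (A t * Φ t) i j) (Icc a b) := fun i j =>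
      ((hA.matrix_mul hΦ).matrix_elem i j).continuousOn
    have h := fun j => ibp (a := a) (b := t) ht.1 (f := fun t => Φ t i j) (F := fun t => z t j)
      (f' := fun t => (A t * Φ t) i j) (g := fun τ => (Ψ τ *ᵥ g τ) j)
      (ftc (ht.1.trans ht.2) (hdc i j) (fun s hs => hd s hs i j) t ht).1
      (hz' t ht j).1
      (fun s hs => (ftc (ht.1.trans ht.2) (hdc i j) (fun s hs => hd s hs i j) s
        ⟨hs.1, hs.2.trans ht.2⟩).2)
      (fun s hs => by
        rw [hz0]
        simp only [Pi.zero_apply, zero_add]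
        exact (hz' s ⟨hs.1, hs.2.trans ht.2⟩ j).2)
    have e : (fun τ => (A τ *ᵥ (Φ τ *ᵥ z τ) + Φ τ *ᵥ (Ψ τ *ᵥ g τ)) i) =
        fun τ => ∑ j, ((A τ * Φ τ) i j * z τ j + Φ τ i j * (Ψ τ *ᵥ g τ) j) := by
      funext τ
      rw [Finset.sum_add_distrib, Matrix.mulVec_mulVec]
      rfl
    rw [e]
    refine ⟨by simpa only [Finset.sum_fn] using IntervalIntegrable.sum Finset.univ (fun j _ => (h j).1), ?_⟩
    rw [intervalIntegral.integral_finsetSum (fun j _ => (h j).1)]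
    change ∑ j, Φ t i j * z t j = _
    refine Finset.sum_congr rfl fun j _ => ?_
    rw [← (h j).2, hz0]
    simp
  refine hab0.congr fun t ht => ?_
  rw [Matrix.mulVec_mulVec _ (Φ t) (Ψ t), h1 t ht, Matrix.one_mulVec]

theorem pd_pos {ι : Type*} [Fintype ι] {M : Matrix ι ι ℝ} (h : M.PosDef) {v : ι → ℝ} (hv : v ≠ 0) :
    0 < v ⬝ᵥ (M *ᵥ v) := by simpa using h.dotProduct_mulVec_pos hv

theorem pd_nonneg {ι : Type*} [Fintype ι] {M : Matrix ι ι ℝ} (h : M.PosDef) (v : ι → ℝ) :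
    0 ≤ v ⬝ᵥ (M *ᵥ v) := by
  by_cases hv : v = 0
  · simp [hv]
  · exact (pd_pos h hv).le

theorem pd_symm {ι : Type*} [Fintype ι] {M : Matrix ι ι ℝ} (h : M.PosDef) : Mᵀ = M := by
  have := h.isHermitian
  rwa [Matrix.IsHermitian, Matrix.conjTranspose_eq_transpose_of_trivial] at this

theorem dot_tr {ι κ : Type*} [Fintype ι] [Fintype κ] (M : Matrix ι κ ℝ) (u : ι → ℝ) (v : κ → ℝ) :
    (Mᵀ *ᵥ u) ⬝ᵥ v = u ⬝ᵥ (M *ᵥ v) := by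
  rw [Matrix.mulVec_transpose, Matrix.dotProduct_mulVec]

theorem dot_sym {ι : Type*} [Fintype ι] {M : Matrix ι ι ℝ} (h : Mᵀ = M) (u v : ι → ℝ) :
    u ⬝ᵥ (M *ᵥ v) = v ⬝ᵥ (M *ᵥ u) := by
  rw [← dot_tr, h, dotProduct_comm]

theorem young {ι : Type*} [Fintype ι] [DecidableEq ι] {R : Matrix ι ι ℝ} (h : R.PosDef)
    (u w : ι → ℝ) : 2 * (u ⬝ᵥ w) ≤ u ⬝ᵥ (R⁻¹ *ᵥ u) + w ⬝ᵥ (R *ᵥ w) := by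
  have h0 := pd_nonneg h (w - R⁻¹ *ᵥ u)
  have hu : IsUnit R.det := (Matrix.isUnit_iff_isUnit_det _).1 h.isUnit
  have e : R *ᵥ (R⁻¹ *ᵥ u) = u := by
    rw [Matrix.mulVec_mulVec, Matrix.mul_nonsing_inv _ hu, Matrix.one_mulVec]
  rw [Matrix.mulVec_sub, e, sub_dotProduct, dotProduct_sub, dotProduct_sub,
    dot_sym (pd_symm h) (R⁻¹ *ᵥ u) w, e, dotProduct_comm w u, dotProduct_comm (R⁻¹ *ᵥ u) u] at h0
  linarith


theorem quad_hasDeriv {κ : Type*} [Fintype κ] {H H' : ℝ → Matrix κ κ ℝ} {a b : ℝ}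
    (h : MD H H' a b) (v : κ → ℝ) :
    ∀ t ∈ Icc a b, HasDerivWithinAt (fun s => v ⬝ᵥ (H s *ᵥ v)) (v ⬝ᵥ (H' t *ᵥ v)) (Icc a b) t := by
  intro t ht
  simp only [dotProduct, Matrix.mulVec]
  refine HasDerivWithinAt.fun_sum fun i _ => ?_
  refine HasDerivWithinAt.const_mul _ ?_
  exact HasDerivWithinAt.fun_sum fun j _ => (h t ht i j).mul_const _

theorem quad_congr {κ l : Type*} [Fintype κ] [Fintype l] (M : Matrix κ κ ℝ) (P : Matrix l κ ℝ)
    (v : l → ℝ) : v ⬝ᵥ ((P * M * Pᵀ) *ᵥ v) = (Pᵀ *ᵥ v) ⬝ᵥ (M *ᵥ (Pᵀ *ᵥ v)) := by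
  rw [dot_tr, Matrix.mulVec_mulVec, Matrix.mulVec_mulVec, Matrix.mul_assoc]

theorem energy {κ l : Type*} [Fintype κ] [DecidableEq κ] [Fintype l] [DecidableEq l]
    {a b : ℝ} (hab : a ≤ b)
    {A : ℝ → Matrix κ κ ℝ} (hA : Continuous A) {G : ℝ → Matrix κ l ℝ}
    {R : ℝ → Matrix l l ℝ} (hRpd : ∀ t ∈ Icc a b, (R t).PosDef)
    {W W' : ℝ → Matrix κ κ ℝ} (hW : MD W W' a b)
    (hW'c : ∀ i j, ContinuousOn (fun t => W' t i j) (Icc a b))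
    (hW0 : ∀ v, 0 ≤ v ⬝ᵥ (W a *ᵥ v))
    (hD : ∀ t ∈ Icc a b, ∀ v, v ⬝ᵥ ((G t * (R t)⁻¹ * (G t)ᵀ) *ᵥ v) ≤
      v ⬝ᵥ ((W' t - A t * W t - W t * (A t)ᵀ) *ᵥ v))
    {w : ℝ → l → ℝ}
    (hw : IntervalIntegrable (fun τ => w τ ⬝ᵥ (R τ *ᵥ w τ)) volume a b)
    (hw1 : (∫ τ in a..b, w τ ⬝ᵥ (R τ *ᵥ w τ)) ≤ 1)
    {x : ℝ → κ → ℝ} (hx : Sol a b (fun τ => A τ *ᵥ x τ + G τ *ᵥ w τ) x)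
    {t : ℝ} (ht : t ∈ Icc a b) (η : κ → ℝ) :
    2 * (η ⬝ᵥ x t) ≤ η ⬝ᵥ (W t *ᵥ η) + 1 := by
  obtain ⟨Φ, Ψ, hΦc, hΨc, hΦ, hΨ, h1, h2⟩ := fund hab A hA
  have hadj := adjoint_formula hA hΨc hΨ hx ht
  set θ := (Φ t)ᵀ *ᵥ η with hθ
  have hθ1 : (Ψ t)ᵀ *ᵥ θ = η := by
    rw [hθ, Matrix.mulVec_mulVec, ← Matrix.transpose_mul, h2 t ht, Matrix.transpose_one,
      Matrix.one_mulVec]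
  have hint : IntervalIntegrable (fun τ => θ ⬝ᵥ (Ψ τ *ᵥ (G τ *ᵥ w τ))) volume a t := by
    simp only [dotProduct]
    simpa only [Finset.sum_fn] using
      IntervalIntegrable.sum Finset.univ (fun j _ => (hadj j).1.const_mul (θ j))
  have e1 : η ⬝ᵥ x t = ∫ τ in a..t, θ ⬝ᵥ (Ψ τ *ᵥ (G τ *ᵥ w τ)) := by
    rw [← hθ1, dot_tr]
    simp only [dotProduct]
    rw [intervalIntegral.integral_finsetSum (fun j _ => (hadj j).1.const_mul (θ j))]
    refine Finset.sum_congr rfl fun j _ => ?_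
    rw [intervalIntegral.integral_const_mul, (hadj j).2]
  set H' : ℝ → Matrix κ κ ℝ := fun t => Ψ t * (W' t - A t * W t - W t * (A t)ᵀ) * (Ψ t)ᵀ with hH'
  have hH : MD (fun t => Ψ t * W t * (Ψ t)ᵀ) H' a b := by
    refine ((hΨ.mul hW).mul hΨ.transpose).congr (fun _ _ => rfl) fun t ht => ?_
    simp only [hH', Matrix.transpose_neg, Matrix.transpose_mul]
    noncomm_ring
  have hWc : Continuous (fun t => W (clampI a b t)) := cont_clamp hab hW.contOn
  have hW'c2 : Continuous (fun t => W' (clampI a b t)) := cont_clamp hab hW'c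
  have hq := quad_hasDeriv hH θ
  have hqc : ContinuousOn (fun t => θ ⬝ᵥ (H' t *ᵥ θ)) (Icc a b) := by
    have : Continuous (fun t => θ ⬝ᵥ ((Ψ t * (W' (clampI a b t) - A t * W (clampI a b t) -
        W (clampI a b t) * (A t)ᵀ) * (Ψ t)ᵀ) *ᵥ θ)) :=
      continuous_const.dotProduct (((hΨc.matrix_mul ((hW'c2.sub (hA.matrix_mul hWc)).sub
        (hWc.matrix_mul hA.matrix_transpose))).matrix_mul
        hΨc.matrix_transpose).matrix_mulVec continuous_const)
    refine this.continuousOn.congr fun t ht => ?_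
    simp only [hH', clampI_eq ht]
  have hf := ftc hab hqc hq t ht
  have hwt : IntervalIntegrable (fun τ => w τ ⬝ᵥ (R τ *ᵥ w τ)) volume a t := by
    refine hw.mono_set ?_
    rw [uIcc_of_le ht.1, uIcc_of_le hab]
    exact Icc_subset_Icc_right ht.2
  have hw2 : (∫ τ in a..t, w τ ⬝ᵥ (R τ *ᵥ w τ)) ≤ 1 := by
    refine le_trans ?_ hw1
    have hwr : IntervalIntegrable (fun τ => w τ ⬝ᵥ (R τ *ᵥ w τ)) volume t b := by
      refine hw.mono_set ?_
      rw [uIcc_of_le ht.2, uIcc_of_le hab]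
      exact Icc_subset_Icc_left ht.1
    rw [← intervalIntegral.integral_add_adjacent_intervals hwt hwr]
    have : 0 ≤ ∫ τ in t..b, w τ ⬝ᵥ (R τ *ᵥ w τ) :=
      intervalIntegral.integral_nonneg ht.2 fun u hu =>
        pd_nonneg (hRpd u ⟨ht.1.trans hu.1, hu.2⟩) _
    linarith
  have hle : (∫ τ in a..t, 2 * (θ ⬝ᵥ (Ψ τ *ᵥ (G τ *ᵥ w τ)))) ≤
      ∫ τ in a..t, (θ ⬝ᵥ (H' τ *ᵥ θ) + w τ ⬝ᵥ (R τ *ᵥ w τ)) := by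
    refine intervalIntegral.integral_mono_on ht.1 (hint.const_mul 2) (hf.1.add hwt) fun s hs => ?_
    have hs' : s ∈ Icc a b := ⟨hs.1, hs.2.trans ht.2⟩
    have y := young (hRpd s hs') ((G s)ᵀ *ᵥ ((Ψ s)ᵀ *ᵥ θ)) (w s)
    rw [dot_tr, dot_tr, ← quad_congr] at y
    have := hD s hs' ((Ψ s)ᵀ *ᵥ θ)
    rw [← quad_congr (W' s - A s * W s - W s * (A s)ᵀ)] at this
    simp only [hH']
    linarith
  rw [intervalIntegral.integral_const_mul, ← e1, intervalIntegral.integral_add hf.1 hwt] at hle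
  have e2 := hf.2
  rw [quad_congr, hθ1, quad_congr] at e2
  have := hW0 ((Ψ a)ᵀ *ᵥ θ)
  linarith

theorem normalize_vec {ι : Type*} [Fintype ι] {v : ι → ℝ} (hv : v ≠ 0) :
    ∃ c : ℝ, 0 < c ∧ ∃ u : ι → ℝ, u ⬝ᵥ u = 1 ∧ v = c • u := by
  have h0 : 0 < v ⬝ᵥ v := by
    have : v ⬝ᵥ v ≠ 0 := fun h => hv (dotProduct_self_eq_zero.1 h)
    have h2 : 0 ≤ v ⬝ᵥ v := Finset.sum_nonneg fun i _ => mul_self_nonneg _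
    exact lt_of_le_of_ne h2 this.symm
  have hs := Real.sqrt_pos.2 h0
  refine ⟨Real.sqrt (v ⬝ᵥ v), hs, (Real.sqrt (v ⬝ᵥ v))⁻¹ • v, ?_, ?_⟩
  · rw [smul_dotProduct, dotProduct_smul, smul_eq_mul, smul_eq_mul]
    have := Real.mul_self_sqrt h0.le
    field_simp
    rw [sq, this]
  · rw [smul_smul, mul_inv_cancel₀ hs.ne', one_smul]

theorem sphere_compact (ι : Type*) [Fintype ι] : IsCompact {v : ι → ℝ | v ⬝ᵥ v = 1} := by
  refine Metric.isCompact_of_isClosed_isBounded ?_ ?_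
  · exact isClosed_eq (by fun_prop) continuous_const
  · refine (Metric.isBounded_closedBall (x := (0 : ι → ℝ)) (r := 1)).subset fun v hv => ?_
    rw [mem_closedBall_zero_iff]
    refine (pi_norm_le_iff_of_nonneg zero_le_one).2 fun i => ?_
    have h1 : v i * v i ≤ 1 := by
      rw [← show v ⬝ᵥ v = 1 from hv]
      exact Finset.single_le_sum (f := fun i => v i * v i) (fun i _ => mul_self_nonneg _)
        (Finset.mem_univ i)
    rw [Real.norm_eq_abs]
    exact abs_le_one_iff_mul_self_le_one.2 h1

theorem quad_smul {ι : Type*} [Fintype ι] (M : Matrix ι ι ℝ) (c : ℝ) (u : ι → ℝ) :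
    (c • u) ⬝ᵥ (M *ᵥ (c • u)) = c ^ 2 * (u ⬝ᵥ (M *ᵥ u)) := by
  rw [Matrix.mulVec_smul, smul_dotProduct, dotProduct_smul, smul_eq_mul, smul_eq_mul]; ring

/-- If `g ≥ 0` and `f > 0` wherever `g = 0` on a compact set, then `f + k g > 0` for some `k`. -/
theorem compact_large {X : Type*} [TopologicalSpace X] {K : Set X} (hK : IsCompact K)
    {f g : X → ℝ} (hf : Continuous f) (hg : Continuous g) (hg0 : ∀ x ∈ K, 0 ≤ g x)
    (h : ∀ x ∈ K, g x = 0 → 0 < f x) : ∃ k : ℝ, 0 < k ∧ ∀ x ∈ K, 0 < f x + k * g x := by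
  have hK2 : IsCompact (K ∩ {x | f x ≤ 0}) := hK.inter_right (isClosed_le hf continuous_const)
  rcases (K ∩ {x | f x ≤ 0}).eq_empty_or_nonempty with he | hne
  · refine ⟨1, one_pos, fun x hx => ?_⟩
    have : 0 < f x := by
      by_contra hc
      have : x ∈ K ∩ {x | f x ≤ 0} := ⟨hx, not_lt.1 hc⟩
      rw [he] at this; exact this
    have := hg0 x hx
    linarith
  · obtain ⟨x1, hx1, hm1⟩ := hK2.exists_isMinOn hne hf.continuousOn
    obtain ⟨x2, hx2, hm2⟩ := hK2.exists_isMinOn hne hg.continuousOn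
    have hg2 : 0 < g x2 := lt_of_le_of_ne (hg0 x2 hx2.1) fun e =>
      absurd (h x2 hx2.1 e.symm) (not_lt.2 hx2.2)
    have hf1 : f x1 ≤ 0 := hx1.2
    refine ⟨(1 - f x1) / g x2, div_pos (by linarith) hg2, fun x hx => ?_⟩
    by_cases hx0 : f x ≤ 0
    · have h1 : f x1 ≤ f x := hm1 ⟨hx, hx0⟩
      have h2 : g x2 ≤ g x := hm2 ⟨hx, hx0⟩
      have h3 : (1 - f x1) ≤ (1 - f x1) / g x2 * g x := by
        rw [div_mul_eq_mul_div, le_div_iff₀ hg2]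
        exact mul_le_mul_of_nonneg_left h2 (by linarith)
      linarith
    · have := hg0 x hx
      have : 0 ≤ (1 - f x1) / g x2 * g x := mul_nonneg (div_nonneg (by linarith) hg2.le) this
      linarith

theorem large_mat {ι κ : Type*} [Fintype ι] [Fintype κ] {a b : ℝ} {F : ℝ → Matrix ι ι ℝ}
    {B : ℝ → Matrix ι κ ℝ} (hF : Continuous F) (hB : Continuous B)
    (h : ∀ t ∈ Icc a b, ∀ v, v ≠ 0 → (B t)ᵀ *ᵥ v = 0 → v ⬝ᵥ (F t *ᵥ v) < 0) :
    ∃ k : ℝ, 0 < k ∧ ∀ t ∈ Icc a b, ∀ v, v ≠ 0 →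
      v ⬝ᵥ (F t *ᵥ v) < k * (v ⬝ᵥ ((B t * (B t)ᵀ) *ᵥ v)) := by
  have hBB : ∀ t v, v ⬝ᵥ ((B t * (B t)ᵀ) *ᵥ v) = ((B t)ᵀ *ᵥ v) ⬝ᵥ ((B t)ᵀ *ᵥ v) := by
    intro t v; rw [dot_tr, Matrix.mulVec_mulVec]
  obtain ⟨k, hk, h2⟩ := compact_large (isCompact_Icc.prod (sphere_compact ι))
    (K := Icc a b ×ˢ {v : ι → ℝ | v ⬝ᵥ v = 1})
    (f := fun p => -(p.2 ⬝ᵥ (F p.1 *ᵥ p.2)))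
    (g := fun p => p.2 ⬝ᵥ ((B p.1 * (B p.1)ᵀ) *ᵥ p.2)) (by fun_prop) (by fun_prop)
    (fun p _ => by
      rw [hBB]; exact Finset.sum_nonneg fun i _ => mul_self_nonneg _)
    (fun p hp h0 => by
      have := h p.1 hp.1 p.2 (by
        rintro h; have := hp.2; simp [h] at this) (by
        rw [hBB] at h0; exact dotProduct_self_eq_zero.1 h0)
      linarith)
  refine ⟨k, hk, fun t ht v hv => ?_⟩
  obtain ⟨c, hc, u, hu, rfl⟩ := normalize_vec hv
  have := h2 (t, u) ⟨ht, hu⟩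
  simp only at this
  rw [quad_smul, quad_smul]
  have : 0 < c ^ 2 * (-(u ⬝ᵥ F t *ᵥ u) + k * u ⬝ᵥ (B t * (B t)ᵀ) *ᵥ u) := by positivity
  linarith

theorem small_mat {ι : Type*} [Fintype ι] {a b : ℝ} {F H : ℝ → Matrix ι ι ℝ}
    (hF : Continuous F) (hH : Continuous H)
    (h : ∀ t ∈ Icc a b, ∀ v, v ≠ 0 → 0 < v ⬝ᵥ (F t *ᵥ v)) :
    ∃ e : ℝ, 0 < e ∧ e ≤ 1 ∧ ∀ t ∈ Icc a b, ∀ v, v ≠ 0 →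
      e * (v ⬝ᵥ (H t *ᵥ v)) < v ⬝ᵥ (F t *ᵥ v) := by
  obtain ⟨k, hk, h2⟩ := compact_large (isCompact_Icc.prod (sphere_compact ι))
    (K := Icc a b ×ˢ {v : ι → ℝ | v ⬝ᵥ v = 1})
    (f := fun p => -(p.2 ⬝ᵥ (H p.1 *ᵥ p.2)))
    (g := fun p => p.2 ⬝ᵥ (F p.1 *ᵥ p.2)) (by fun_prop) (by fun_prop)
    (fun p hp => (h p.1 hp.1 p.2 (by rintro h; have := hp.2; simp [h] at this)).le)
    (fun p hp h0 => by
      have := h p.1 hp.1 p.2 (by rintro h; have := hp.2; simp [h] at this)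
      linarith)
  have hk1 : 0 < max k 1 := by positivity
  refine ⟨(max k 1)⁻¹, by positivity, inv_le_one_of_one_le₀ (le_max_right _ _), fun t ht v hv => ?_⟩
  have hv0 := h t ht v hv
  rw [inv_mul_lt_iff₀ hk1]
  refine lt_of_lt_of_le ?_ (mul_le_mul_of_nonneg_right (le_max_left k 1) hv0.le)
  obtain ⟨c, hc, u, hu, rfl⟩ := normalize_vec hv
  have := h2 (t, u) ⟨ht, hu⟩
  simp only at this
  rw [quad_smul, quad_smul]
  have : 0 < c ^ 2 * (-(u ⬝ᵥ H t *ᵥ u) + k * u ⬝ᵥ F t *ᵥ u) := by positivity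
  linarith


theorem int_dot {κ : Type*} [Fintype κ] {a t : ℝ} (f : ℝ → κ → ℝ) (hf : Continuous f)
    (v : κ → ℝ) : (∫ τ in a..t, v ⬝ᵥ f τ) = v ⬝ᵥ fun i => ∫ τ in a..t, f τ i := by
  simp only [dotProduct]
  have h : ∀ i ∈ Finset.univ, IntervalIntegrable (fun τ => v i * f τ i) volume a t := fun i _ =>
    (continuous_const.mul ((continuous_apply i).comp hf)).intervalIntegrable _ _
  rw [intervalIntegral.integral_finsetSum h]
  refine Finset.sum_congr rfl fun j _ => ?_
  rw [intervalIntegral.integral_const_mul]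

theorem ii_ind {E : Type*} [NormedAddCommGroup E] {f : ℝ → E} (hf : Continuous f) (t x y : ℝ) :
    IntervalIntegrable (indicator {τ | τ ≤ t} f) volume x y := by
  have hms : MeasurableSet {τ : ℝ | τ ≤ t} := measurableSet_Iic
  have := (hf.intervalIntegrable (μ := volume) x y)
  exact ⟨this.1.indicator hms, this.2.indicator hms⟩

theorem gram_gain {κ l p : Type*} [Fintype κ] [DecidableEq κ] [Fintype l] [DecidableEq l]
    [Fintype p] [DecidableEq p]
    {a b : ℝ}
    {A Φ Ψ X : ℝ → Matrix κ κ ℝ} (hA : Continuous A) {G : ℝ → Matrix κ l ℝ} (hG : Continuous G)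
    {R : ℝ → Matrix l l ℝ} (hR : Continuous R) (hRpd : ∀ t, (R t).PosDef)
    {C : ℝ → Matrix p κ ℝ}
    {Q : ℝ → Matrix p p ℝ} (hQpd : ∀ t, (Q t).PosDef)
    (hΦc : Continuous Φ) (hΨc : Continuous Ψ)
    (hΦ : MD Φ (fun t => A t * Φ t) a b)
    (h2 : ∀ t ∈ Icc a b, Φ t * Ψ t = 1)
    (hX : ∀ t, X t = Matrix.of fun i j => ∫ τ in a..t, (Ψ τ * (G τ * (R τ)⁻¹ * (G τ)ᵀ) * (Ψ τ)ᵀ) i j)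
    (hio : ∀ w : ℝ → l → ℝ, Measurable w →
      IntervalIntegrable (fun τ => w τ ⬝ᵥ (R τ *ᵥ w τ)) volume a b →
      (∫ τ in a..b, w τ ⬝ᵥ (R τ *ᵥ w τ)) ≤ 1 →
      ∀ x : ℝ → κ → ℝ, Sol a b (fun τ => A τ *ᵥ x τ + G τ *ᵥ w τ) x →
      ∀ t ∈ Icc a b, (C t *ᵥ x t) ⬝ᵥ (Q t *ᵥ (C t *ᵥ x t)) < 1)
    {t : ℝ} (ht : t ∈ Icc a b) {ζ : p → ℝ} (hζ : ζ ≠ 0) :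
    ζ ⬝ᵥ ((C t * (Φ t * X t * (Φ t)ᵀ) * (C t)ᵀ) *ᵥ ζ) < ζ ⬝ᵥ ((Q t)⁻¹ *ᵥ ζ) := by
  have hζ0 : 0 < ζ ⬝ᵥ ((Q t)⁻¹ *ᵥ ζ) := pd_pos (hQpd t).inv hζ
  set c := ζ ⬝ᵥ ((C t * (Φ t * X t * (Φ t)ᵀ) * (C t)ᵀ) *ᵥ ζ) with hc
  rcases le_or_gt c 0 with h0 | h0
  · linarith
  set θ := (Φ t)ᵀ *ᵥ ((C t)ᵀ *ᵥ ζ) with hθ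
  have hRi : Continuous fun τ => (R τ)⁻¹ := cont_inv hR fun t => (hRpd t).isUnit
  set H : ℝ → Matrix κ κ ℝ := fun τ => Ψ τ * (G τ * (R τ)⁻¹ * (G τ)ᵀ) * (Ψ τ)ᵀ with hH
  have hHc : Continuous H := (hΨc.matrix_mul ((hG.matrix_mul hRi).matrix_mul
    hG.matrix_transpose)).matrix_mul hΨc.matrix_transpose
  set s := (Real.sqrt c)⁻¹ with hs
  have hs2 : s ^ 2 * c = 1 := by
    rw [hs, inv_pow, Real.sq_sqrt h0.le, inv_mul_cancel₀ h0.ne']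
  have hspos : 0 < s := by rw [hs]; exact inv_pos.2 (Real.sqrt_pos.2 h0)
  set u : ℝ → l → ℝ := fun τ => s • ((R τ)⁻¹ *ᵥ ((G τ)ᵀ *ᵥ ((Ψ τ)ᵀ *ᵥ θ))) with hu
  have huc : Continuous u := Continuous.const_smul (hRi.matrix_mulVec
    (hG.matrix_transpose.matrix_mulVec (hΨc.matrix_transpose.matrix_mulVec continuous_const))) s
  have hXi : ∀ v i, (X t *ᵥ v) i = ∫ τ in a..t, (H τ *ᵥ v) i := by
    intro v i
    have h1 : ∀ τ, (H τ *ᵥ v) i = v ⬝ᵥ H τ i := fun τ => dotProduct_comm _ _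
    simp only [h1]
    rw [int_dot (fun τ => H τ i) ((continuous_apply i).comp hHc), hX]
    exact dotProduct_comm _ _
  have hcX : c = θ ⬝ᵥ (X t *ᵥ θ) := by
    rw [hc, quad_congr, quad_congr]
  have hXq : c = ∫ τ in a..t, θ ⬝ᵥ (H τ *ᵥ θ) := by
    rw [hcX]
    rw [int_dot (fun τ => H τ *ᵥ θ) (hHc.matrix_mulVec continuous_const)]
    congr 1
    funext i
    exact hXi θ i
  have huR : ∀ τ, u τ ⬝ᵥ (R τ *ᵥ u τ) = s ^ 2 * (θ ⬝ᵥ (H τ *ᵥ θ)) := by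
    intro τ
    have hu' : IsUnit (R τ).det := (Matrix.isUnit_iff_isUnit_det _).1 (hRpd τ).isUnit
    simp only [hu, hH]
    rw [quad_smul, quad_congr, quad_congr, Matrix.mulVec_mulVec _ (R τ), Matrix.mul_nonsing_inv _ hu',
      Matrix.one_mulVec, dotProduct_comm]
  have hΨG : ∀ τ, Ψ τ *ᵥ (G τ *ᵥ u τ) = s • (H τ *ᵥ θ) := by
    intro τ
    simp only [hu, hH, Matrix.mulVec_smul, Matrix.mulVec_mulVec, Matrix.mul_assoc]
  set w : ℝ → l → ℝ := indicator {τ | τ ≤ t} u with hw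
  have hms : MeasurableSet {τ : ℝ | τ ≤ t} := measurableSet_Iic
  have hwR : (fun τ => w τ ⬝ᵥ (R τ *ᵥ w τ)) =
      indicator {τ | τ ≤ t} (fun τ => s ^ 2 * (θ ⬝ᵥ (H τ *ᵥ θ))) := by
    funext τ
    by_cases hτ : τ ∈ {τ : ℝ | τ ≤ t}
    · simp only [hw, indicator_of_mem hτ, huR]
    · simp only [hw, indicator_of_notMem hτ, zero_dotProduct]
  have hqc : Continuous (fun τ => s ^ 2 * (θ ⬝ᵥ (H τ *ᵥ θ))) :=
    continuous_const.mul (continuous_const.dotProduct (hHc.matrix_mulVec continuous_const))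
  have hgI : (fun τ => Ψ τ *ᵥ (G τ *ᵥ w τ)) = indicator {τ | τ ≤ t} (fun τ => s • (H τ *ᵥ θ)) := by
    funext τ
    by_cases hτ : τ ∈ {τ : ℝ | τ ≤ t}
    · simp only [hw, indicator_of_mem hτ, hΨG]
    · simp only [hw, indicator_of_notMem hτ, Matrix.mulVec_zero]
  have hgc : Continuous (fun τ => s • (H τ *ᵥ θ)) :=
    Continuous.const_smul (hHc.matrix_mulVec continuous_const) s
  have hz : Sol a b (fun τ => Ψ τ *ᵥ (G τ *ᵥ w τ))
      (fun t' => ∫ τ in a..t', Ψ τ *ᵥ (G τ *ᵥ w τ)) := by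
    intro t' _
    refine ⟨?_, rfl⟩
    rw [hgI]
    exact ii_ind hgc _ _ _
  have hx := voc hA hΦc hΨc hΦ h2 hz
  have hfin := hio w (huc.measurable.indicator hms) (by rw [hwR]; exact ii_ind hqc _ _ _) (by
    rw [hwR, intervalIntegral.integral_indicator ht, intervalIntegral.integral_const_mul, ← hXq, hs2])
    _ hx t ht
  have hzt : (∫ τ in a..t, Ψ τ *ᵥ (G τ *ᵥ w τ)) = s • (X t *ᵥ θ) := by
    have : (∫ τ in a..t, Ψ τ *ᵥ (G τ *ᵥ w τ)) = ∫ τ in a..t, s • (H τ *ᵥ θ) := by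
      rw [hgI]
      refine intervalIntegral.integral_congr fun τ hτ => ?_
      rw [uIcc_of_le ht.1] at hτ
      exact indicator_of_mem (show τ ∈ {τ : ℝ | τ ≤ t} from hτ.2) _
    rw [this, intervalIntegral.integral_smul]
    congr 1
    ext i
    rw [int_eval, hXi]
    exact fun i => ((continuous_apply i).comp
      (hHc.matrix_mulVec continuous_const)).intervalIntegrable _ _
  simp only [hzt] at hfin
  set y := C t *ᵥ Φ t *ᵥ (s • X t *ᵥ θ) with hy
  have hζy : ζ ⬝ᵥ y = s * c := by
    rw [hy, ← dot_tr, ← dot_tr, ← hθ, dotProduct_smul, ← hcX, smul_eq_mul]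
  have yo := young (hQpd t) (s • ζ) y
  rw [quad_smul, smul_dotProduct, hζy, smul_eq_mul] at yo
  have h3 : s * (s * c) = 1 := by rw [← hs2]; ring
  have h4 : 1 < s ^ 2 * (ζ ⬝ᵥ ((Q t)⁻¹ *ᵥ ζ)) := by linarith
  rw [← hs2] at h4
  exact lt_of_mul_lt_mul_left h4 (by positivity)


theorem pd_of {ι : Type*} [Fintype ι] {M : Matrix ι ι ℝ} (hs : Mᵀ = M)
    (h : ∀ v, v ≠ 0 → 0 < v ⬝ᵥ (M *ᵥ v)) : M.PosDef := by
  refine Matrix.PosDef.of_dotProduct_mulVec_pos ?_ ?_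
  · rw [Matrix.IsHermitian, Matrix.conjTranspose_eq_transpose_of_trivial, hs]
  · intro v hv
    simpa using h v hv

theorem sym_GRG {κ l : Type*} [Fintype l] [DecidableEq l] {R : Matrix l l ℝ}
    (h : R.PosDef) (G : Matrix κ l ℝ) : (G * R⁻¹ * Gᵀ)ᵀ = G * R⁻¹ * Gᵀ := by
  rw [Matrix.transpose_mul, Matrix.transpose_mul, Matrix.transpose_transpose,
    pd_symm h.inv, Matrix.mul_assoc]

theorem GRG_nonneg {κ l : Type*} [Fintype κ] [Fintype l] [DecidableEq l] {R : Matrix l l ℝ}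
    (h : R.PosDef) (G : Matrix κ l ℝ) (v : κ → ℝ) : 0 ≤ v ⬝ᵥ ((G * R⁻¹ * Gᵀ) *ᵥ v) := by
  rw [quad_congr]; exact pd_nonneg h.inv _

theorem gram {κ l p : Type*} [Fintype κ] [DecidableEq κ] [Fintype l] [DecidableEq l]
    [Fintype p] [DecidableEq p]
    {a b : ℝ} (hab : a < b)
    {A : ℝ → Matrix κ κ ℝ} (hA : Continuous A) {G : ℝ → Matrix κ l ℝ} (hG : Continuous G)
    {R : ℝ → Matrix l l ℝ} (hR : Continuous R) (hRpd : ∀ t, (R t).PosDef)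
    {C : ℝ → Matrix p κ ℝ} (hC : Continuous C)
    {Q : ℝ → Matrix p p ℝ} (hQ : Continuous Q) (hQpd : ∀ t, (Q t).PosDef)
    (hio : ∀ w : ℝ → l → ℝ, Measurable w →
      IntervalIntegrable (fun τ => w τ ⬝ᵥ (R τ *ᵥ w τ)) volume a b →
      (∫ τ in a..b, w τ ⬝ᵥ (R τ *ᵥ w τ)) ≤ 1 →
      ∀ x : ℝ → κ → ℝ, Sol a b (fun τ => A τ *ᵥ x τ + G τ *ᵥ w τ) x →
      ∀ t ∈ Icc a b, (C t *ᵥ x t) ⬝ᵥ (Q t *ᵥ (C t *ᵥ x t)) < 1) :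
    ∃ W W' E : ℝ → Matrix κ κ ℝ, Continuous W ∧ Continuous W' ∧ Continuous E ∧ MD W W' a b ∧
      (∀ t ∈ Icc a b, (W t).PosDef) ∧ (∀ t ∈ Icc a b, (E t).PosDef) ∧
      (∀ t ∈ Icc a b, W' t = A t * W t + W t * (A t)ᵀ + G t * (R t)⁻¹ * (G t)ᵀ + E t) ∧
      (∀ t ∈ Icc a b, ∀ ζ, ζ ≠ 0 → ζ ⬝ᵥ ((C t * W t * (C t)ᵀ) *ᵥ ζ) < ζ ⬝ᵥ ((Q t)⁻¹ *ᵥ ζ)) := by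
  obtain ⟨Φ, Ψ, hΦc, hΨc, hΦ, hΨ, h1, h2⟩ := fund hab.le A hA
  have hRi : Continuous fun τ => (R τ)⁻¹ := cont_inv hR fun t => (hRpd t).isUnit
  have hQi : Continuous fun τ => (Q τ)⁻¹ := cont_inv hQ fun t => (hQpd t).isUnit
  set H : ℝ → Matrix κ κ ℝ := fun τ => Ψ τ * (G τ * (R τ)⁻¹ * (G τ)ᵀ) * (Ψ τ)ᵀ with hH
  have hGc : Continuous (fun t => G t * (R t)⁻¹ * (G t)ᵀ) :=
    (hG.matrix_mul hRi).matrix_mul hG.matrix_transpose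
  have hHc : Continuous H := (hΨc.matrix_mul hGc).matrix_mul hΨc.matrix_transpose
  set X : ℝ → Matrix κ κ ℝ := fun t => Matrix.of fun i j => ∫ τ in a..t, H τ i j with hX
  have hXd : ∀ i j t, HasDerivAt (fun s => X s i j) (H t i j) t := fun i j t =>
    ((hHc.matrix_elem i j).integral_hasStrictDerivAt a t).hasDerivAt
  have hXc : Continuous X := continuous_matrix fun i j =>
    continuous_iff_continuousAt.2 fun t => (hXd i j t).continuousAt
  have hXMD : MD X H a b := fun t _ i j => (hXd i j t).hasDerivWithinAt
  have hHs : ∀ t, (H t)ᵀ = H t := by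
    intro t
    simp only [hH]
    rw [Matrix.transpose_mul, Matrix.transpose_mul, Matrix.transpose_transpose,
      sym_GRG (hRpd t)]
    simp only [Matrix.mul_assoc]
  have hXs : ∀ t, (X t)ᵀ = X t := by
    intro t
    ext i j
    simp only [hX, Matrix.transpose_apply, Matrix.of_apply]
    congr 1
    funext τ
    conv_rhs => rw [← hHs τ]
    rfl
  have hX0 : X a = 0 := by
    ext i j; simp [hX]
  have hXn : ∀ t ∈ Icc a b, ∀ v, 0 ≤ v ⬝ᵥ (X t *ᵥ v) := by
    intro t ht v
    have := (ftc hab.le (Continuous.continuousOn (continuous_const.dotProduct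
      (hHc.matrix_mulVec continuous_const))) (quad_hasDeriv hXMD v) t ht).2
    rw [this, hX0, Matrix.zero_mulVec, dotProduct_zero, zero_add]
    refine intervalIntegral.integral_nonneg ht.1 fun τ _ => ?_
    simp only [hH]
    rw [quad_congr]
    exact GRG_nonneg (hRpd τ) _ _
  have hgain : ∀ t ∈ Icc a b, ∀ ζ, ζ ≠ 0 →
      ζ ⬝ᵥ ((C t * (Φ t * X t * (Φ t)ᵀ) * (C t)ᵀ) *ᵥ ζ) < ζ ⬝ᵥ ((Q t)⁻¹ *ᵥ ζ) :=
    fun t ht ζ hζ => gram_gain hA hG hR hRpd hQpd hΦc hΨc hΦ h2 (fun _ => rfl) hio ht hζ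
  have hWc0 : Continuous (fun t => C t * (Φ t * X t * (Φ t)ᵀ) * (C t)ᵀ) :=
    (hC.matrix_mul ((hΦc.matrix_mul hXc).matrix_mul hΦc.matrix_transpose)).matrix_mul
      hC.matrix_transpose
  have hPP : Continuous (fun t => Φ t * (Φ t)ᵀ) := hΦc.matrix_mul hΦc.matrix_transpose
  have hlin : Continuous (fun t : ℝ => 1 + (t - a)) := by fun_prop
  have hWc1 : Continuous (fun t => (1 + (t - a)) • (C t * (Φ t * (Φ t)ᵀ) * (C t)ᵀ)) :=
    hlin.smul ((hC.matrix_mul hPP).matrix_mul hC.matrix_transpose)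
  obtain ⟨e, he0, -, he⟩ := small_mat (a := a) (b := b) (hQi.fun_sub hWc0) hWc1 (by
    intro t ht v hv
    have := hgain t ht v hv
    rw [Matrix.sub_mulVec, dotProduct_sub]
    linarith)
  have hinj : ∀ t ∈ Icc a b, ∀ v, v ≠ 0 → (Φ t)ᵀ *ᵥ v ≠ 0 := by
    intro t ht v hv h
    apply hv
    have : (Ψ t)ᵀ *ᵥ ((Φ t)ᵀ *ᵥ v) = v := by
      rw [Matrix.mulVec_mulVec, ← Matrix.transpose_mul, h2 t ht, Matrix.transpose_one,
        Matrix.one_mulVec]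
    rw [← this, h, Matrix.mulVec_zero]
  have hΦΦ : ∀ t ∈ Icc a b, ∀ v, v ≠ 0 → 0 < v ⬝ᵥ ((Φ t * (Φ t)ᵀ) *ᵥ v) := by
    intro t ht v hv
    rw [← Matrix.mulVec_mulVec, ← dot_tr]
    have h0 := hinj t ht v hv
    refine lt_of_le_of_ne (Finset.sum_nonneg fun i _ => mul_self_nonneg _) fun h => h0 ?_
    exact dotProduct_self_eq_zero.1 h.symm
  have hW0MD : MD (fun t => Φ t * X t * (Φ t)ᵀ) (fun t => (A t * Φ t * X t + Φ t * H t) * (Φ t)ᵀ +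
      Φ t * X t * (A t * Φ t)ᵀ) a b := (hΦ.mul hXMD).mul hΦ.transpose
  have hPMD : MD (fun t => (e * (1 + (t - a))) • (Φ t * (Φ t)ᵀ))
      (fun t => (e * (1 + (t - a))) • (A t * Φ t * (Φ t)ᵀ + Φ t * (A t * Φ t)ᵀ) +
        e • (Φ t * (Φ t)ᵀ)) a b := by
    intro t ht i j
    have h0 := (hΦ.mul hΦ.transpose) t ht i j
    have hl : HasDerivWithinAt (fun t : ℝ => e * (1 + (t - a))) e (Icc a b) t := by
      have := (((hasDerivWithinAt_id t (Icc a b)).sub_const a).const_add 1).const_mul e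
      simpa using this
    have := hl.fun_mul h0
    simp only [Matrix.smul_apply, Matrix.add_apply, smul_eq_mul] at this ⊢
    exact this.congr_deriv (by ring)
  refine ⟨fun t => Φ t * X t * (Φ t)ᵀ + (e * (1 + (t - a))) • (Φ t * (Φ t)ᵀ),
    fun t => A t * (Φ t * X t * (Φ t)ᵀ + (e * (1 + (t - a))) • (Φ t * (Φ t)ᵀ)) +
      (Φ t * X t * (Φ t)ᵀ + (e * (1 + (t - a))) • (Φ t * (Φ t)ᵀ)) * (A t)ᵀ +
      G t * (R t)⁻¹ * (G t)ᵀ + e • (Φ t * (Φ t)ᵀ),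
    fun t => e • (Φ t * (Φ t)ᵀ), ?_, ?_, ?_, ?_, ?_, ?_, ?_, ?_⟩
  · exact ((hΦc.matrix_mul hXc).matrix_mul hΦc.matrix_transpose).add
      ((continuous_const.mul hlin).smul hPP)
  · have : Continuous (fun t => Φ t * X t * (Φ t)ᵀ + (e * (1 + (t - a))) • (Φ t * (Φ t)ᵀ)) :=
      ((hΦc.matrix_mul hXc).matrix_mul hΦc.matrix_transpose).add
      ((continuous_const.mul hlin).smul hPP)
    exact (((hA.matrix_mul this).add (this.matrix_mul hA.matrix_transpose)).add hGc).add
      (hPP.const_smul e)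
  · exact hPP.const_smul e
  · refine (hW0MD.add hPMD).congr (fun _ _ => rfl) fun t ht => ?_
    have hG1 : G t * (R t)⁻¹ * (G t)ᵀ = Φ t * H t * (Φ t)ᵀ := by
      simp only [hH]
      have : Φ t * (Ψ t * (G t * (R t)⁻¹ * (G t)ᵀ) * (Ψ t)ᵀ) * (Φ t)ᵀ =
        (Φ t * Ψ t) * (G t * (R t)⁻¹ * (G t)ᵀ) * (Φ t * Ψ t)ᵀ := by
        rw [Matrix.transpose_mul]; noncomm_ring
      rw [this, h2 t ht, Matrix.transpose_one, Matrix.one_mul, Matrix.mul_one]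
    rw [hG1]
    simp only [Matrix.transpose_mul, Matrix.mul_add, Matrix.add_mul, smul_add, Matrix.mul_smul,
      Matrix.smul_mul, Matrix.mul_assoc]
    abel
  · intro t ht
    refine pd_of ?_ ?_
    · simp only [Matrix.transpose_add, Matrix.transpose_smul, Matrix.transpose_mul,
        Matrix.transpose_transpose, hXs, Matrix.mul_assoc]
    · intro v hv
      rw [Matrix.add_mulVec, dotProduct_add, Matrix.smul_mulVec, dotProduct_smul, smul_eq_mul,
        quad_congr]
      have h3 := hXn t ht ((Φ t)ᵀ *ᵥ v)
      have h4 := hΦΦ t ht v hv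
      have h5 : 0 < e * (1 + (t - a)) := mul_pos he0 (by linarith [ht.1])
      have := mul_pos h5 h4
      linarith
  · intro t ht
    refine pd_of ?_ ?_
    · simp only [Matrix.transpose_smul, Matrix.transpose_mul, Matrix.transpose_transpose]
    · intro v hv
      rw [Matrix.smul_mulVec, dotProduct_smul, smul_eq_mul]
      exact mul_pos he0 (hΦΦ t ht v hv)
  · intro t _; rfl
  · intro t ht ζ hζ
    have := he t ht ζ hζ
    simp only [Matrix.sub_mulVec, dotProduct_sub, Matrix.smul_mulVec, dotProduct_smul,
      smul_eq_mul] at this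
    simp only [Matrix.mul_add, Matrix.add_mul, Matrix.mul_smul, Matrix.smul_mul,
      Matrix.add_mulVec, dotProduct_add, Matrix.smul_mulVec, dotProduct_smul, smul_eq_mul]
    linarith


/-- The three-block matrix pattern of the two matrix inequalities. -/
theorem form3 {n r : Type*} [Fintype n] [Fintype r]
    (X Y Z : Matrix n n ℝ) (K : Matrix n r ℝ) (K' : Matrix r n ℝ) (hK : K' = Kᵀ)
    (L : Matrix r r ℝ) (a b : n → ℝ) (c : r → ℝ) :
    (Sum.elim (Sum.elim a b) c) ⬝ᵥ ((fromBlocks (fromBlocks X Y Yᵀ Z)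
      (fromRows (0 : Matrix n r ℝ) K) (fromCols (0 : Matrix r n ℝ) K') L) *ᵥ
      (Sum.elim (Sum.elim a b) c)) =
    a ⬝ᵥ (X *ᵥ a) + 2 * (a ⬝ᵥ (Y *ᵥ b)) + b ⬝ᵥ (Z *ᵥ b) + 2 * (b ⬝ᵥ (K *ᵥ c)) +
      c ⬝ᵥ (L *ᵥ c) := by
  subst hK
  have e1 : b ⬝ᵥ (Yᵀ *ᵥ a) = a ⬝ᵥ (Y *ᵥ b) := by rw [dotProduct_comm, dot_tr]
  have e2 : c ⬝ᵥ (Kᵀ *ᵥ b) = b ⬝ᵥ (K *ᵥ c) := by rw [dotProduct_comm, dot_tr]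
  simp only [fromBlocks_mulVec, sumElim_dotProduct_sumElim, Sum.elim_comp_inl, Sum.elim_comp_inr,
    fromRows_mulVec, fromCols_mulVec_sumElim, dotProduct_add, Matrix.zero_mulVec,
    dotProduct_zero, e1, e2, zero_add]
  ring

theorem form3_symm {n r : Type*}
    {X Y Z : Matrix n n ℝ} {K : Matrix n r ℝ} {K' : Matrix r n ℝ} (hK : K' = Kᵀ)
    {L : Matrix r r ℝ} (hX : Xᵀ = X) (hZ : Zᵀ = Z) (hL : Lᵀ = L) :
    (fromBlocks (fromBlocks X Y Yᵀ Z)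
      (fromRows (0 : Matrix n r ℝ) K) (fromCols (0 : Matrix r n ℝ) K') L)ᵀ =
    (fromBlocks (fromBlocks X Y Yᵀ Z)
      (fromRows (0 : Matrix n r ℝ) K) (fromCols (0 : Matrix r n ℝ) K') L) := by
  subst hK
  simp only [fromBlocks_transpose, transpose_fromRows, transpose_fromCols, hX, hZ, hL,
    transpose_transpose, transpose_zero]

theorem exists_elim3 {n r : Type*} (v : (n ⊕ n) ⊕ r → ℝ) :
    ∃ a b c, v = Sum.elim (Sum.elim a b) c :=
  ⟨fun i => v (Sum.inl (Sum.inl i)), fun i => v (Sum.inl (Sum.inr i)), fun i => v (Sum.inr i), by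
    ext ((i | i) | i) <;> rfl⟩

theorem fwd_a {n r : Type*} [Fintype n] [Fintype r] [DecidableEq r]
    {X Y Z T : Matrix n n ℝ} {G : Matrix n r ℝ} {R : Matrix r r ℝ} (hR : R.PosDef)
    (hX : Xᵀ = X) (hZ : Zᵀ = Z) (hT : Tᵀ = T) (hY : Y = 0)
    (h1 : ∀ v, v ≠ 0 → v ⬝ᵥ (X *ᵥ v) < 0)
    (h2 : ∀ v, v ≠ 0 → v ⬝ᵥ ((Z + T * (G * R⁻¹ * Gᵀ) * T) *ᵥ v) < 0) :
    (-(fromBlocks (fromBlocks X Y Yᵀ Z)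
      (fromRows (0 : Matrix n r ℝ) (T * G)) (fromCols (0 : Matrix r n ℝ) (Gᵀ * T)) (-R))).PosDef := by
  have hK : Gᵀ * T = (T * G)ᵀ := by rw [transpose_mul, hT]
  refine pd_of ?_ ?_
  · rw [transpose_neg, form3_symm hK hX hZ (by rw [transpose_neg, pd_symm hR])]
  · intro v hv
    obtain ⟨a, b, c, rfl⟩ := exists_elim3 v
    rw [Matrix.neg_mulVec, dotProduct_neg, form3 X Y Z _ _ hK, hY]
    simp only [Matrix.neg_mulVec, dotProduct_neg, Matrix.zero_mulVec, dotProduct_zero]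
    have y := young hR ((T * G)ᵀ *ᵥ b) c
    rw [dot_tr, ← quad_congr] at y
    have e : b ⬝ᵥ ((T * G * R⁻¹ * (T * G)ᵀ) *ᵥ b) = b ⬝ᵥ ((T * (G * R⁻¹ * Gᵀ) * T) *ᵥ b) := by
      rw [← hK]; simp only [Matrix.mul_assoc]
    rw [e] at y
    have hz : b ⬝ᵥ ((Z + T * (G * R⁻¹ * Gᵀ) * T) *ᵥ b) = b ⬝ᵥ (Z *ᵥ b) +
        b ⬝ᵥ ((T * (G * R⁻¹ * Gᵀ) * T) *ᵥ b) := by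
      rw [Matrix.add_mulVec, dotProduct_add]
    by_cases ha : a = 0
    · by_cases hb : b = 0
      · have hc : c ≠ 0 := by
          rintro rfl; apply hv; rw [ha, hb]; ext ((i | i) | i) <;> rfl
        have := pd_pos hR hc
        simp only [ha, hb, zero_dotProduct]
        linarith
      · have := h2 b hb
        simp only [ha, zero_dotProduct]
        linarith
    · have := h1 a ha
      by_cases hb : b = 0
      · have := pd_nonneg hR c
        simp only [hb, zero_dotProduct]
        linarith
      · have := h2 b hb
        linarith

theorem inv_gain {κ p : Type*} [Fintype κ] [DecidableEq κ] [Fintype p] [DecidableEq p]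
    {W : Matrix κ κ ℝ} (hW : W.PosDef) {C : Matrix p κ ℝ} {Q : Matrix p p ℝ} (hQ : Q.PosDef)
    (h : ∀ ζ, ζ ≠ 0 → ζ ⬝ᵥ ((C * W * Cᵀ) *ᵥ ζ) < ζ ⬝ᵥ (Q⁻¹ *ᵥ ζ)) {ξ : κ → ℝ} (hξ : ξ ≠ 0) :
    (C *ᵥ ξ) ⬝ᵥ (Q *ᵥ (C *ᵥ ξ)) < ξ ⬝ᵥ (W⁻¹ *ᵥ ξ) := by
  by_cases hy : C *ᵥ ξ = 0
  · rw [hy, zero_dotProduct]; exact pd_pos hW.inv hξ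
  have hQu : IsUnit Q.det := (Matrix.isUnit_iff_isUnit_det _).1 hQ.isUnit
  have hWu : IsUnit W.det := (Matrix.isUnit_iff_isUnit_det _).1 hW.isUnit
  have e0 : Q⁻¹ *ᵥ (Q *ᵥ (C *ᵥ ξ)) = C *ᵥ ξ := by
    rw [Matrix.mulVec_mulVec _ Q⁻¹, Matrix.nonsing_inv_mul _ hQu, Matrix.one_mulVec]
  have hζ : Q *ᵥ (C *ᵥ ξ) ≠ 0 := by
    intro h0; apply hy; rw [← e0, h0, Matrix.mulVec_zero]
  have h1 := h _ hζ
  have y := young hW.inv (Cᵀ *ᵥ (Q *ᵥ (C *ᵥ ξ))) ξ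
  rw [Matrix.nonsing_inv_nonsing_inv _ hWu, ← quad_congr, dot_tr] at y
  rw [e0] at h1
  have e1 : (Q *ᵥ (C *ᵥ ξ)) ⬝ᵥ (C *ᵥ ξ) = (C *ᵥ ξ) ⬝ᵥ (Q *ᵥ (C *ᵥ ξ)) := dotProduct_comm _ _
  rw [e1] at y h1
  linarith

theorem fwd_b {n p : Type*} [Fintype n] [DecidableEq n] [Fintype p] [DecidableEq p]
    {W : Matrix (n ⊕ n) (n ⊕ n) ℝ} (hW : W.PosDef) {C : Matrix p n ℝ} {Q : Matrix p p ℝ}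
    (hQ : Q.PosDef)
    (h : ∀ ζ, ζ ≠ 0 → ζ ⬝ᵥ ((fromCols C (0 : Matrix p n ℝ) * W * (fromCols C (0 : Matrix p n ℝ))ᵀ)
      *ᵥ ζ) < ζ ⬝ᵥ (Q⁻¹ *ᵥ ζ)) {e : ℝ} (he : 0 < e) {S T : Matrix n n ℝ}
    (hS : S = W.toBlocks₁₁) (hT : T = W⁻¹.toBlocks₁₁ + e • (1 : Matrix n n ℝ))
    (hSs : Sᵀ = S) (hTs : Tᵀ = T) :
    (fromBlocks (fromBlocks (T - Cᵀ * Q * C) (1 - Cᵀ * Q * C * S) (1 - Cᵀ * Q * C * S)ᵀ S)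
      (fromRows (0 : Matrix n p ℝ) (S * Cᵀ)) (fromCols (0 : Matrix p n ℝ) (C * S)) Q⁻¹).PosDef := by
  have hK : C * S = (S * Cᵀ)ᵀ := by rw [transpose_mul, hSs, transpose_transpose]
  have hWu : IsUnit W.det := (Matrix.isUnit_iff_isUnit_det _).1 hW.isUnit
  have hQs := pd_symm hQ
  refine pd_of ?_ ?_
  · refine form3_symm hK ?_ hSs (pd_symm hQ.inv)
    simp only [transpose_sub, transpose_mul, hTs, hQs, transpose_transpose, Matrix.mul_assoc]
  · intro v hv
    obtain ⟨a, b, c, rfl⟩ := exists_elim3 v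
    rw [form3 _ _ _ _ _ hK]
    set ξ : n ⊕ n → ℝ := Sum.elim a 0 + W *ᵥ Sum.elim b 0 with hξ
    have hWv : ∀ (M : Matrix (n ⊕ n) (n ⊕ n) ℝ) (u v : n → ℝ),
        (Sum.elim u 0) ⬝ᵥ (M *ᵥ (Sum.elim v 0)) = u ⬝ᵥ (M.toBlocks₁₁ *ᵥ v) := by
      intro M u v
      rw [← fromBlocks_toBlocks M, fromBlocks_mulVec, sumElim_dotProduct_sumElim]
      simp
    have hWW : W⁻¹ *ᵥ (W *ᵥ Sum.elim b 0) = Sum.elim b 0 := by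
      rw [Matrix.mulVec_mulVec, Matrix.nonsing_inv_mul _ hWu, Matrix.one_mulVec]
    have eξ : ξ ⬝ᵥ (W⁻¹ *ᵥ ξ) = a ⬝ᵥ (W⁻¹.toBlocks₁₁ *ᵥ a) + 2 * (a ⬝ᵥ b) + b ⬝ᵥ (S *ᵥ b) := by
      rw [hξ, Matrix.mulVec_add, hWW, add_dotProduct, dotProduct_add, dotProduct_add,
        hWv, dot_sym (pd_symm hW.inv) (W *ᵥ Sum.elim b 0), hWW,
        dotProduct_comm (W *ᵥ Sum.elim b 0), hWv, sumElim_dotProduct_sumElim, hS]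
      simp
      ring
    have eC : fromCols C (0 : Matrix p n ℝ) *ᵥ ξ = C *ᵥ a + C *ᵥ (S *ᵥ b) := by
      rw [hξ, Matrix.mulVec_add, fromCols_mulVec_sumElim]
      congr 1
      · simp
      · rw [hS, ← fromBlocks_toBlocks W, fromBlocks_mulVec, fromCols_mulVec_sumElim]
        simp
    have y := young hQ c (-(C *ᵥ (S *ᵥ b)))
    rw [dotProduct_neg, Matrix.mulVec_neg, neg_dotProduct, dotProduct_neg, neg_neg] at y
    have e1 : b ⬝ᵥ ((S * Cᵀ) *ᵥ c) = c ⬝ᵥ (C *ᵥ (S *ᵥ b)) := by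
      rw [← dot_tr, ← hK, dotProduct_comm, Matrix.mulVec_mulVec]
    have e2 : a ⬝ᵥ ((T - Cᵀ * Q * C) *ᵥ a) = a ⬝ᵥ (W⁻¹.toBlocks₁₁ *ᵥ a) + e * (a ⬝ᵥ a) -
        (C *ᵥ a) ⬝ᵥ (Q *ᵥ (C *ᵥ a)) := by
      have := quad_congr Q Cᵀ a
      rw [transpose_transpose] at this
      rw [Matrix.sub_mulVec, dotProduct_sub, this, hT, Matrix.add_mulVec, dotProduct_add,
        Matrix.smul_mulVec, Matrix.one_mulVec, dotProduct_smul, smul_eq_mul]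
    have e3 : a ⬝ᵥ ((1 - Cᵀ * Q * C * S) *ᵥ b) = a ⬝ᵥ b -
        (C *ᵥ a) ⬝ᵥ (Q *ᵥ (C *ᵥ (S *ᵥ b))) := by
      rw [Matrix.sub_mulVec, dotProduct_sub, Matrix.one_mulVec]
      simp only [← Matrix.mulVec_mulVec]
      rw [← dot_tr, transpose_transpose]
    have e4 : (fromCols C (0 : Matrix p n ℝ) *ᵥ ξ) ⬝ᵥ (Q *ᵥ (fromCols C (0 : Matrix p n ℝ) *ᵥ ξ)) =
        (C *ᵥ a) ⬝ᵥ (Q *ᵥ (C *ᵥ a)) + 2 * ((C *ᵥ a) ⬝ᵥ (Q *ᵥ (C *ᵥ (S *ᵥ b)))) +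
        (C *ᵥ (S *ᵥ b)) ⬝ᵥ (Q *ᵥ (C *ᵥ (S *ᵥ b))) := by
      rw [eC, Matrix.mulVec_add, add_dotProduct, dotProduct_add, dotProduct_add,
        dot_sym hQs (C *ᵥ (S *ᵥ b)) (C *ᵥ a)]
      ring
    rw [e1, e2, e3]
    by_cases hab : a = 0 ∧ b = 0
    · obtain ⟨rfl, rfl⟩ := hab
      have hc : c ≠ 0 := by
        rintro rfl; apply hv; ext ((i | i) | i) <;> rfl
      have := pd_pos hQ.inv hc
      simpa using this
    · have haa : 0 ≤ a ⬝ᵥ a := Finset.sum_nonneg fun i _ => mul_self_nonneg _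
      by_cases hx : ξ = 0
      · have ha : a ≠ 0 := by
          rintro rfl
          have : W⁻¹ *ᵥ ξ = Sum.elim b 0 := by
            rw [hξ]
            have h0 : (Sum.elim (0 : n → ℝ) (0 : n → ℝ)) = 0 := by ext (i | i) <;> rfl
            rw [h0, zero_add, hWW]
          rw [hx, Matrix.mulVec_zero] at this
          apply hab
          refine ⟨rfl, ?_⟩
          ext i
          exact (congrFun this (Sum.inl i)).symm
        have : 0 < a ⬝ᵥ a := lt_of_le_of_ne haa fun h => ha (dotProduct_self_eq_zero.1 h.symm)
        have := mul_pos he this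
        rw [hx] at eξ e4
        simp only [Matrix.mulVec_zero, dotProduct_zero] at eξ e4
        linarith
      · have := inv_gain hW hQ h hx
        have := mul_nonneg he.le haa
        linarith


theorem tb_mul {n : Type*} [Fintype n] (X Y : Matrix (n ⊕ n) (n ⊕ n) ℝ) :
    (X * Y).toBlocks₁₁ = X.toBlocks₁₁ * Y.toBlocks₁₁ + X.toBlocks₁₂ * Y.toBlocks₂₁ := by
  conv_lhs => rw [← fromBlocks_toBlocks X, ← fromBlocks_toBlocks Y, fromBlocks_multiply]
  rw [toBlocks_fromBlocks₁₁]

theorem tb_add {n : Type*} (X Y : Matrix (n ⊕ n) (n ⊕ n) ℝ) :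
    (X + Y).toBlocks₁₁ = X.toBlocks₁₁ + Y.toBlocks₁₁ := rfl

theorem tb_neg {n : Type*} (X : Matrix (n ⊕ n) (n ⊕ n) ℝ) :
    (-X).toBlocks₁₁ = -X.toBlocks₁₁ := rfl

theorem tb_quad {n : Type*} [Fintype n] (M : Matrix (n ⊕ n) (n ⊕ n) ℝ) (u v : n → ℝ) :
    u ⬝ᵥ (M.toBlocks₁₁ *ᵥ v) = (Sum.elim u 0) ⬝ᵥ (M *ᵥ (Sum.elim v 0)) := by
  conv_rhs => rw [← fromBlocks_toBlocks M, fromBlocks_mulVec, sumElim_dotProduct_sumElim]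
  simp

theorem tb_pos {n : Type*} [Fintype n] {M : Matrix (n ⊕ n) (n ⊕ n) ℝ} (h : M.PosDef)
    {v : n → ℝ} (hv : v ≠ 0) : 0 < v ⬝ᵥ (M.toBlocks₁₁ *ᵥ v) := by
  rw [tb_quad]
  refine pd_pos h fun h0 => hv ?_
  ext i
  exact congrFun h0 (Sum.inl i)

theorem gcl {n r : Type*} [Fintype r] (G : Matrix n r ℝ) (M : Matrix r r ℝ) :
    fromRows G (0 : Matrix n r ℝ) * M * (fromRows G (0 : Matrix n r ℝ))ᵀ =
      fromBlocks (G * M * Gᵀ) 0 0 0 := by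
  rw [transpose_fromRows, fromRows_mul, fromRows_mul_fromCols]
  simp

theorem fwd_alg1 {n q p : Type*} [Fintype n] [Fintype q] [Fintype p]
    {A AK g : Matrix n n ℝ} {B : Matrix n q ℝ} {C : Matrix p n ℝ} {BK : Matrix n p ℝ}
    {CK : Matrix q n ℝ} {DK : Matrix q p ℝ} {W W' E : Matrix (n ⊕ n) (n ⊕ n) ℝ} (hW : Wᵀ = W)
    (h : W' = fromBlocks (A + B * DK * C) (B * CK) (BK * C) AK * W +
      W * (fromBlocks (A + B * DK * C) (B * CK) (BK * C) AK)ᵀ + fromBlocks g 0 0 0 + E) :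
    -W'.toBlocks₁₁ + A * W.toBlocks₁₁ + W.toBlocks₁₁ * Aᵀ +
      B * (DK * C * W.toBlocks₁₁ + CK * W.toBlocks₂₁) +
      (DK * C * W.toBlocks₁₁ + CK * W.toBlocks₂₁)ᵀ * Bᵀ + g = -E.toBlocks₁₁ := by
  have h11 : (W.toBlocks₁₁)ᵀ = W.toBlocks₁₁ := by
    conv_rhs => rw [← hW]
    rfl
  have h21 : (W.toBlocks₂₁)ᵀ = W.toBlocks₁₂ := by
    conv_rhs => rw [← hW]
    rfl
  rw [h, fromBlocks_transpose, tb_add, tb_add, tb_add, tb_mul, tb_mul]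
  simp only [toBlocks_fromBlocks₁₁, toBlocks_fromBlocks₁₂, toBlocks_fromBlocks₂₁,
    transpose_add, transpose_mul, h11, h21, Matrix.mul_add, Matrix.add_mul, Matrix.mul_assoc]
  abel

theorem fwd_alg2 {n q p : Type*} [Fintype n] [DecidableEq n] [Fintype q] [Fintype p]
    {A AK g : Matrix n n ℝ} {B : Matrix n q ℝ} {C : Matrix p n ℝ} {BK : Matrix n p ℝ}
    {CK : Matrix q n ℝ} {DK : Matrix q p ℝ} {W W' E P : Matrix (n ⊕ n) (n ⊕ n) ℝ}
    (hP : Pᵀ = P) (h1 : P * W = 1) (h2 : W * P = 1) (e : ℝ)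
    (h : W' = fromBlocks (A + B * DK * C) (B * CK) (BK * C) AK * W +
      W * (fromBlocks (A + B * DK * C) (B * CK) (BK * C) AK)ᵀ + fromBlocks g 0 0 0 + E) :
    (-(P * W' * P)).toBlocks₁₁ + (P.toBlocks₁₁ + e • (1 : Matrix n n ℝ)) * A +
      Aᵀ * (P.toBlocks₁₁ + e • (1 : Matrix n n ℝ)) +
      (P.toBlocks₁₁ * B * DK + P.toBlocks₁₂ * BK) * C +
      Cᵀ * (P.toBlocks₁₁ * B * DK + P.toBlocks₁₂ * BK)ᵀ +
      (P.toBlocks₁₁ + e • (1 : Matrix n n ℝ)) * g * (P.toBlocks₁₁ + e • (1 : Matrix n n ℝ)) =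
    -(P * E * P).toBlocks₁₁ + (e • (A + Aᵀ + g * P.toBlocks₁₁ + P.toBlocks₁₁ * g) +
      (e * e) • g) := by
  have h11 : (P.toBlocks₁₁)ᵀ = P.toBlocks₁₁ := by
    conv_rhs => rw [← hP]
    rfl
  have h12 : (P.toBlocks₁₂)ᵀ = P.toBlocks₂₁ := by
    conv_rhs => rw [← hP]
    rfl
  have hm : P * W' * P = P * fromBlocks (A + B * DK * C) (B * CK) (BK * C) AK +
      (fromBlocks (A + B * DK * C) (B * CK) (BK * C) AK)ᵀ * P + P * fromBlocks g 0 0 0 * P +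
      P * E * P := by
    rw [h]
    generalize fromBlocks (A + B * DK * C) (B * CK) (BK * C) AK = K
    generalize fromBlocks g (0 : Matrix n n ℝ) (0 : Matrix n n ℝ) (0 : Matrix n n ℝ) = L
    have e1 : P * (K * W + W * Kᵀ + L + E) * P = P * K * (W * P) + (P * W) * Kᵀ * P + P * L * P +
        P * E * P := by noncomm_ring
    rw [e1, h1, h2, Matrix.mul_one, Matrix.one_mul]
  rw [hm, fromBlocks_transpose, tb_neg, tb_add, tb_add, tb_add, tb_mul, tb_mul,
    tb_mul (P * _) P, tb_mul P (fromBlocks g 0 0 0)]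
  have h0 : (P * fromBlocks g (0 : Matrix n n ℝ) (0 : Matrix n n ℝ) (0 : Matrix n n ℝ)).toBlocks₁₂
      = 0 := by
    conv_lhs => rw [← fromBlocks_toBlocks P, fromBlocks_multiply, toBlocks_fromBlocks₁₂]
    simp
  rw [h0]
  generalize (P * E * P).toBlocks₁₁ = F
  simp only [toBlocks_fromBlocks₁₁, toBlocks_fromBlocks₁₂, toBlocks_fromBlocks₂₁,
    transpose_add, transpose_mul, h11, h12, Matrix.mul_add, Matrix.add_mul, Matrix.mul_assoc,
    Matrix.mul_smul, Matrix.smul_mul, Matrix.mul_one, Matrix.one_mul, smul_add, smul_smul,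
    Matrix.mul_zero, Matrix.zero_mul, neg_add]
  abel


theorem th22_symm {n m : Type*} [Fintype n] [Fintype m] {X T : Matrix n n ℝ} (hX : Xᵀ = X)
    (hT : Tᵀ = T) (A : Matrix n n ℝ) (K : Matrix n m ℝ) (C : Matrix m n ℝ) :
    (X + T * A + Aᵀ * T + K * C + Cᵀ * Kᵀ)ᵀ = X + T * A + Aᵀ * T + K * C + Cᵀ * Kᵀ := by
  simp only [transpose_add, transpose_mul, transpose_transpose, hX, hT]
  abel

theorem forward {n q r m : Type*} [Fintype n] [DecidableEq n] [Fintype q]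
    [Fintype r] [DecidableEq r] [Fintype m] [DecidableEq m] {a b : ℝ} (hab : a < b)
    {A : ℝ → Matrix n n ℝ} {B : ℝ → Matrix n q ℝ} {G : ℝ → Matrix n r ℝ}
    {C : ℝ → Matrix m n ℝ} {R : ℝ → Matrix r r ℝ} {Q : ℝ → Matrix m m ℝ}
    (hA : Continuous A) (hB : Continuous B) (hG : Continuous G) (hC : Continuous C)
    (hR : Continuous R) (hQ : Continuous Q)
    (hRpd : ∀ t, (R t).PosDef) (hQpd : ∀ t, (Q t).PosDef)
    {AK : ℝ → Matrix n n ℝ} {BK : ℝ → Matrix n m ℝ} {CK : ℝ → Matrix q n ℝ}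
    {DK : ℝ → Matrix q m ℝ}
    (hAKc : Continuous AK) (hBKc : Continuous BK) (hCKc : Continuous CK) (hDKc : Continuous DK)
    (hio : ∀ w : ℝ → r → ℝ, Measurable w →
      IntervalIntegrable (fun τ => w τ ⬝ᵥ (R τ *ᵥ w τ)) volume a b →
      (∫ τ in a..b, w τ ⬝ᵥ (R τ *ᵥ w τ)) ≤ 1 →
      ∀ x : ℝ → n ⊕ n → ℝ, Sol a b (fun τ => fromBlocks (A τ + B τ * DK τ * C τ) (B τ * CK τ)
                  (BK τ * C τ) (AK τ) *ᵥ x τ + fromRows (G τ) 0 *ᵥ w τ) x →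
      ∀ t ∈ Icc a b, (fromCols (C t) 0 *ᵥ x t) ⬝ᵥ (Q t *ᵥ (fromCols (C t) 0 *ᵥ x t)) < 1) :
    ∃ (S S' Tm Tm' : ℝ → Matrix n n ℝ)
       (hAK : ℝ → Matrix n n ℝ) (hBK : ℝ → Matrix n m ℝ)
       (hCK : ℝ → Matrix q n ℝ),
      (∀ t ∈ Icc a b, (S t)ᵀ = S t ∧ (Tm t)ᵀ = Tm t) ∧
      (∀ i j, ContinuousOn (fun t => S' t i j) (Icc a b)) ∧
      (∀ i j, ContinuousOn (fun t => Tm' t i j) (Icc a b)) ∧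
      MD S S' a b ∧ MD Tm Tm' a b ∧
      (∀ t ∈ Icc a b,
        (-(fromBlocks
            (fromBlocks
              (-(S' t) + A t * S t + S t * (A t)ᵀ + B t * hCK t + (hCK t)ᵀ * (B t)ᵀ +
                G t * (R t)⁻¹ * (G t)ᵀ)
              (A t + (hAK t)ᵀ + B t * DK t * C t + G t * (R t)⁻¹ * (G t)ᵀ * Tm t)
              (A t + (hAK t)ᵀ + B t * DK t * C t + G t * (R t)⁻¹ * (G t)ᵀ * Tm t)ᵀ
              (Tm' t + Tm t * A t + (A t)ᵀ * Tm t + hBK t * C t + (C t)ᵀ * (hBK t)ᵀ))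
            (fromRows (0 : Matrix n r ℝ) (Tm t * G t))
            (fromCols (0 : Matrix r n ℝ) ((G t)ᵀ * Tm t))
            (-(R t)))).PosDef) ∧
      (∀ t ∈ Icc a b,
        (fromBlocks
          (fromBlocks
            (Tm t - (C t)ᵀ * Q t * C t)
            (1 - (C t)ᵀ * Q t * C t * S t)
            (1 - (C t)ᵀ * Q t * C t * S t)ᵀ
            (S t))
          (fromRows (0 : Matrix n m ℝ) (S t * (C t)ᵀ))
          (fromCols (0 : Matrix m n ℝ) (C t * S t))
          ((Q t)⁻¹)).PosDef) := by
  have hRi : Continuous fun τ => (R τ)⁻¹ := cont_inv hR fun t => (hRpd t).isUnit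
  have hgc : Continuous (fun t => G t * (R t)⁻¹ * (G t)ᵀ) :=
    (hG.matrix_mul hRi).matrix_mul hG.matrix_transpose
  have hAcl : Continuous fun τ => fromBlocks (A τ + B τ * DK τ * C τ) (B τ * CK τ)
                  (BK τ * C τ) (AK τ) :=
    Continuous.matrix_fromBlocks (hA.add ((hB.matrix_mul hDKc).matrix_mul hC))
      (hB.matrix_mul hCKc) (hBKc.matrix_mul hC) hAKc
  have hGcl : Continuous fun τ => fromRows (G τ) (0 : Matrix n r ℝ) := by
    refine continuous_matrix fun i j => ?_
    rcases i with i | i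
    · exact hG.matrix_elem i j
    · exact continuous_const
  have hCcl : Continuous fun τ => fromCols (C τ) (0 : Matrix m n ℝ) := by
    refine continuous_matrix fun i j => ?_
    rcases j with j | j
    · exact hC.matrix_elem i j
    · exact continuous_const
  obtain ⟨W, W', E, hWc, hW'c, hEc, hWd, hWpd, hEpd, hW', hgain⟩ :=
    gram hab hAcl hGcl hR hRpd hCcl hQ hQpd hio
  simp only [gcl] at hW'
  have hWu : ∀ t ∈ Icc a b, IsUnit (W t).det := fun t ht =>
    (Matrix.isUnit_iff_isUnit_det _).1 (hWpd t ht).isUnit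
  have hPd := hWd.inv hab fun t ht => (hWpd t ht).isUnit
  have hPc := cont_clamp hab.le hPd.contOn
  -- the choice of the small parameter
  have hFc : Continuous fun t => ((W (clampI a b t))⁻¹ * E t * (W (clampI a b t))⁻¹).toBlocks₁₁ := by
    refine continuous_matrix fun i j => ?_
    exact ((hPc.matrix_mul hEc).matrix_mul hPc).matrix_elem (Sum.inl i) (Sum.inl j)
  have hP1c : Continuous fun t => ((W (clampI a b t))⁻¹).toBlocks₁₁ := by
    refine continuous_matrix fun i j => ?_
    exact hPc.matrix_elem (Sum.inl i) (Sum.inl j)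
  have hHc : Continuous fun t => (A t + (A t)ᵀ + G t * (R t)⁻¹ * (G t)ᵀ *
      ((W (clampI a b t))⁻¹).toBlocks₁₁ + ((W (clampI a b t))⁻¹).toBlocks₁₁ *
      (G t * (R t)⁻¹ * (G t)ᵀ)) + G t * (R t)⁻¹ * (G t)ᵀ :=
    (((hA.add hA.matrix_transpose).add (hgc.matrix_mul hP1c)).add (hP1c.matrix_mul hgc)).add hgc
  have hPEP : ∀ t ∈ Icc a b, ((W t)⁻¹ * E t * (W t)⁻¹).PosDef := by
    intro t ht
    have hPs := pd_symm (hWpd t ht).inv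
    refine pd_of ?_ ?_
    · simp only [transpose_mul, hPs, pd_symm (hEpd t ht), Matrix.mul_assoc]
    · intro v hv
      have := quad_congr (E t) (W t)⁻¹ v
      rw [hPs] at this
      rw [this]
      refine pd_pos (hEpd t ht) fun h0 => hv ?_
      have : W t *ᵥ ((W t)⁻¹ *ᵥ v) = v := by
        rw [Matrix.mulVec_mulVec, Matrix.mul_nonsing_inv _ (hWu t ht), Matrix.one_mulVec]
      rw [← this, h0, Matrix.mulVec_zero]
  obtain ⟨e, he0, he1, he⟩ := small_mat (a := a) (b := b) hFc hHc (by
    intro t ht v hv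
    simp only [clampI_eq ht]
    exact tb_pos (hPEP t ht) hv)
  have hSs : ∀ t ∈ Icc a b, ((W t).toBlocks₁₁)ᵀ = (W t).toBlocks₁₁ := by
    intro t ht
    conv_rhs => rw [← pd_symm (hWpd t ht)]
    rfl
  have hPs : ∀ t ∈ Icc a b, (((W t)⁻¹).toBlocks₁₁)ᵀ = ((W t)⁻¹).toBlocks₁₁ := by
    intro t ht
    conv_rhs => rw [← pd_symm (hWpd t ht).inv]
    rfl
  have hTs : ∀ t ∈ Icc a b, (((W t)⁻¹).toBlocks₁₁ + e • (1 : Matrix n n ℝ))ᵀ =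
      ((W t)⁻¹).toBlocks₁₁ + e • (1 : Matrix n n ℝ) := by
    intro t ht
    rw [transpose_add, hPs t ht, transpose_smul, transpose_one]
  have hW's : ∀ t ∈ Icc a b, (W' t)ᵀ = W' t := by
    intro t ht
    rw [hW' t ht]
    simp only [transpose_add, transpose_mul, transpose_transpose, pd_symm (hWpd t ht),
      pd_symm (hEpd t ht), fromBlocks_transpose, sym_GRG (hRpd t), transpose_zero]
    abel
  refine ⟨fun t => (W t).toBlocks₁₁, fun t => (W' t).toBlocks₁₁,
    fun t => ((W t)⁻¹).toBlocks₁₁ + e • (1 : Matrix n n ℝ),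
    fun t => (-((W t)⁻¹ * W' t * (W t)⁻¹)).toBlocks₁₁,
    fun t => (-(A t + B t * DK t * C t + G t * (R t)⁻¹ * (G t)ᵀ *
      (((W t)⁻¹).toBlocks₁₁ + e • (1 : Matrix n n ℝ))))ᵀ,
    fun t => ((W t)⁻¹).toBlocks₁₁ * B t * DK t + ((W t)⁻¹).toBlocks₁₂ * BK t,
    fun t => DK t * C t * (W t).toBlocks₁₁ + CK t * (W t).toBlocks₂₁,
    fun t ht => ⟨hSs t ht, hTs t ht⟩, ?_, ?_, ?_, ?_, ?_, ?_⟩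
  · exact fun i j => (hW'c.matrix_elem (Sum.inl i) (Sum.inl j)).continuousOn
  · intro i j
    have : Continuous fun t => -((W (clampI a b t))⁻¹ * W' t * (W (clampI a b t))⁻¹) :=
      ((hPc.matrix_mul hW'c).matrix_mul hPc).neg
    refine (this.matrix_elem (Sum.inl i) (Sum.inl j)).continuousOn.congr fun t ht => ?_
    simp only [clampI_eq ht]
    rfl
  · exact fun t ht i j => hWd t ht (Sum.inl i) (Sum.inl j)
  · intro t ht i j
    exact (hPd t ht (Sum.inl i) (Sum.inl j)).add_const _
  · intro t ht
    have a1 := fwd_alg1 (pd_symm (hWpd t ht)) (hW' t ht)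
    have a2 := fwd_alg2 (pd_symm (hWpd t ht).inv) (Matrix.nonsing_inv_mul _ (hWu t ht))
      (Matrix.mul_nonsing_inv _ (hWu t ht)) e (hW' t ht)
    refine fwd_a (hRpd t) ?_ ?_ (hTs t ht) ?_ ?_ ?_
    · rw [a1, transpose_neg]
      congr 1
      conv_rhs => rw [← pd_symm (hEpd t ht)]
      rfl
    · have hP's : ((-((W t)⁻¹ * W' t * (W t)⁻¹)).toBlocks₁₁)ᵀ =
        (-((W t)⁻¹ * W' t * (W t)⁻¹)).toBlocks₁₁ := by
        have : (-((W t)⁻¹ * W' t * (W t)⁻¹))ᵀ = -((W t)⁻¹ * W' t * (W t)⁻¹) := by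
          simp only [transpose_neg, transpose_mul, pd_symm (hWpd t ht).inv, hW's t ht,
            Matrix.mul_assoc]
        conv_rhs => rw [← this]
        rfl
      exact th22_symm hP's (hTs t ht) _ _ _
    · rw [transpose_transpose]
      abel
    · intro v hv
      rw [a1, Matrix.neg_mulVec, dotProduct_neg]
      have := tb_pos (hEpd t ht) hv
      linarith
    · intro v hv
      rw [a2]
      have h1 := he t ht v hv
      simp only [clampI_eq ht] at h1
      have h2 := GRG_nonneg (hRpd t) (G t) v
      rw [Matrix.add_mulVec _ (G t * (R t)⁻¹ * (G t)ᵀ), dotProduct_add] at h1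
      rw [Matrix.add_mulVec, Matrix.add_mulVec, Matrix.neg_mulVec, dotProduct_add, dotProduct_add,
        dotProduct_neg, Matrix.smul_mulVec, Matrix.smul_mulVec, dotProduct_smul, dotProduct_smul,
        smul_eq_mul, smul_eq_mul]
      have h3 : e * e * (v ⬝ᵥ ((G t * (R t)⁻¹ * (G t)ᵀ) *ᵥ v)) ≤
          e * (v ⬝ᵥ ((G t * (R t)⁻¹ * (G t)ᵀ) *ᵥ v)) :=
        mul_le_mul_of_nonneg_right (by nlinarith) h2
      linarith
  · intro t ht
    exact fwd_b (hWpd t ht) (hQpd t) (hgain t ht) he0 rfl rfl (hSs t ht) (hTs t ht)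


theorem bwd_alg {n q p : Type*} [Fintype n] [DecidableEq n] [Fintype q] [Fintype p]
    {A S S' Y Y' N N' M g X1 X2 AK : Matrix n n ℝ} {B : Matrix n q ℝ} {C : Matrix p n ℝ}
    {L : Matrix n p ℝ} {K : Matrix q n ℝ} {k1 k2 : ℝ}
    (hS : Sᵀ = S) (hS' : S'ᵀ = S') (hY : Yᵀ = Y) (hY' : Y'ᵀ = Y') (hg : gᵀ = g) (hM : Mᵀ = M)
    (hN : N = S - Y) (hN' : N' = S' - Y') (h1 : M * N = 1) (h2 : N * M = 1)
    (hX1 : X1 = -S' + A * S + S * Aᵀ + g - k1 • (B * Bᵀ))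
    (hX2 : X2 = -Y' + A * Y + Y * Aᵀ + g - k2 • (Y * Cᵀ * C * Y))
    (hK : K = (-(k1 / 2)) • (Bᵀ * M)) (hL : L = (k2 / 2) • (Y * Cᵀ))
    (hAK : AK = (X1 + N' - A * N - B * K * N - S * Cᵀ * Lᵀ)ᵀ * M) :
    fromBlocks S' N' N' N' = fromBlocks A (B * K) (L * C) AK * fromBlocks S N N N +
      fromBlocks S N N N * (fromBlocks A (B * K) (L * C) AK)ᵀ + fromBlocks g 0 0 0 +
      fromBlocks (-X1) (-X1) (-X1) (-(X1 + X2)) := by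
  have eBK : B * K * N = (-(k1 / 2)) • (B * Bᵀ) := by
    rw [hK, Matrix.mul_smul, Matrix.smul_mul, Matrix.mul_assoc, Matrix.mul_assoc, h1, Matrix.mul_one]
  have hNs : Nᵀ = N := by rw [hN, transpose_sub, hS, hY]
  have eBKt : N * (B * K)ᵀ = (-(k1 / 2)) • (B * Bᵀ) := by
    have := congrArg transpose eBK
    rw [transpose_mul (B * K) N, hNs, transpose_smul, transpose_mul B Bᵀ, transpose_transpose] at this
    exact this
  have eL : Lᵀ = (k2 / 2) • (C * Y) := by
    rw [hL, transpose_smul, transpose_mul, transpose_transpose, hY]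
  have eA1 : AK * N = (X1 + N' - A * N - B * K * N - S * Cᵀ * Lᵀ)ᵀ := by
    rw [hAK, Matrix.mul_assoc, h1, Matrix.mul_one]
  have eA2 : N * AKᵀ = X1 + N' - A * N - B * K * N - S * Cᵀ * Lᵀ := by
    rw [hAK, transpose_mul, transpose_transpose, hM, ← Matrix.mul_assoc, h2, Matrix.one_mul]
  rw [fromBlocks_transpose, fromBlocks_multiply, fromBlocks_multiply, fromBlocks_add,
    fromBlocks_add, fromBlocks_add, eA1, eA2, eBKt, eBK]
  rw [transpose_mul L C, eL, hL]
  simp only [transpose_add, transpose_sub, transpose_mul, transpose_smul, transpose_transpose,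
    transpose_neg, hS, hS', hY, hY', hg, hX1, hX2, hN, hN', Matrix.mul_add, Matrix.add_mul,
    Matrix.mul_sub, Matrix.sub_mul, Matrix.mul_smul, Matrix.smul_mul, Matrix.mul_assoc]
  congr 1 <;> module

/-- Facts read off from the first matrix inequality. -/
theorem bwd_a {n q r m : Type*} [Fintype n] [Fintype q] [Fintype m]
    [Fintype r] [DecidableEq r] {A S S' T T' Y : Matrix n n ℝ} {B : Matrix n q ℝ}
    {G : Matrix n r ℝ} {C : Matrix m n ℝ} {K : Matrix q n ℝ} {L : Matrix n m ℝ}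
    {R : Matrix r r ℝ} (hR : R.PosDef) (hS : Sᵀ = S) (hT : Tᵀ = T)
    (h : (-(fromBlocks (fromBlocks
        (-S' + A * S + S * Aᵀ + B * K + Kᵀ * Bᵀ + G * R⁻¹ * Gᵀ) Y Yᵀ
        (T' + T * A + Aᵀ * T + L * C + Cᵀ * Lᵀ))
      (fromRows (0 : Matrix n r ℝ) (T * G)) (fromCols (0 : Matrix r n ℝ) (Gᵀ * T)) (-R))).PosDef) :
    S'ᵀ = S' ∧ T'ᵀ = T' ∧
    (∀ v, v ≠ 0 → Bᵀ *ᵥ v = 0 → v ⬝ᵥ ((-S' + A * S + S * Aᵀ + G * R⁻¹ * Gᵀ) *ᵥ v) < 0) ∧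
    (∀ v, v ≠ 0 → C *ᵥ v = 0 →
      v ⬝ᵥ ((T' + T * A + Aᵀ * T + T * (G * R⁻¹ * Gᵀ) * T) *ᵥ v) < 0) := by
  have hK : Gᵀ * T = (T * G)ᵀ := by rw [transpose_mul, hT]
  have hsym := pd_symm h
  rw [transpose_neg, neg_inj] at hsym
  have s1 := congrArg (fun M => M.toBlocks₁₁.toBlocks₁₁) hsym
  have s2 := congrArg (fun M => M.toBlocks₁₁.toBlocks₂₂) hsym
  simp only [fromBlocks_transpose, toBlocks_fromBlocks₁₁, toBlocks_fromBlocks₂₂, transpose_add,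
    transpose_mul, transpose_transpose, transpose_neg, hS, hT, sym_GRG hR] at s1 s2
  have hneg : ∀ a b c, (Sum.elim (Sum.elim a b) c : (n ⊕ n) ⊕ r → ℝ) ≠ 0 → _ < (0 : ℝ) :=
    fun a b c hv => by
      have := pd_pos h hv
      rw [Matrix.neg_mulVec, dotProduct_neg, form3 _ _ _ _ _ hK] at this
      exact neg_pos.1 this
  refine ⟨?_, ?_, ?_, ?_⟩
  · have : -S'ᵀ = -S' := by
      have h3 : -S'ᵀ + (A * S + S * Aᵀ + B * K + Kᵀ * Bᵀ + G * R⁻¹ * Gᵀ) =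
        -S' + (A * S + S * Aᵀ + B * K + Kᵀ * Bᵀ + G * R⁻¹ * Gᵀ) := by
        refine Eq.trans ?_ (s1.trans ?_) <;> abel
      exact add_right_cancel h3
    exact neg_inj.1 this
  · have h3 : T'ᵀ + (T * A + Aᵀ * T + L * C + Cᵀ * Lᵀ) = T' + (T * A + Aᵀ * T + L * C + Cᵀ * Lᵀ) := by
      refine Eq.trans ?_ (s2.trans ?_) <;> abel
    exact add_right_cancel h3
  · intro v hv hB
    have := hneg v 0 0 (fun h0 => hv (by ext i; exact congrFun h0 (Sum.inl (Sum.inl i))))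
    have e1 : v ⬝ᵥ ((B * K) *ᵥ v) = 0 := by
      rw [← Matrix.mulVec_mulVec, ← dot_tr, hB, zero_dotProduct]
    have e2 : v ⬝ᵥ ((Kᵀ * Bᵀ) *ᵥ v) = 0 := by
      rw [← Matrix.mulVec_mulVec, hB, Matrix.mulVec_zero, dotProduct_zero]
    simp only [Matrix.mulVec_zero, dotProduct_zero, zero_dotProduct, Matrix.add_mulVec,
      dotProduct_add, e1, e2] at this ⊢
    linarith
  · intro v hv hC
    have := hneg 0 v (R⁻¹ *ᵥ ((Gᵀ * T) *ᵥ v))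
      (fun h0 => hv (by ext i; exact congrFun h0 (Sum.inl (Sum.inr i))))
    have hRu : IsUnit R.det := (Matrix.isUnit_iff_isUnit_det _).1 hR.isUnit
    have e1 : v ⬝ᵥ ((L * C) *ᵥ v) = 0 := by
      rw [← Matrix.mulVec_mulVec, hC, Matrix.mulVec_zero, dotProduct_zero]
    have e2 : v ⬝ᵥ ((Cᵀ * Lᵀ) *ᵥ v) = 0 := by
      rw [← Matrix.mulVec_mulVec, ← dot_tr, transpose_transpose, hC, zero_dotProduct]
    have e3 : v ⬝ᵥ ((T * G) *ᵥ (R⁻¹ *ᵥ ((Gᵀ * T) *ᵥ v))) =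
        v ⬝ᵥ ((T * (G * R⁻¹ * Gᵀ) * T) *ᵥ v) := by
      simp only [Matrix.mulVec_mulVec, Matrix.mul_assoc]
    have e4 : (R⁻¹ *ᵥ ((Gᵀ * T) *ᵥ v)) ⬝ᵥ (R *ᵥ (R⁻¹ *ᵥ ((Gᵀ * T) *ᵥ v))) =
        v ⬝ᵥ ((T * (G * R⁻¹ * Gᵀ) * T) *ᵥ v) := by
      rw [Matrix.mulVec_mulVec _ R, Matrix.mul_nonsing_inv _ hRu, Matrix.one_mulVec,
        dotProduct_comm, hK, dot_tr, ← hK, e3]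
    simp only [Matrix.mulVec_zero, dotProduct_zero, zero_dotProduct, Matrix.add_mulVec,
      dotProduct_add, e1, e2, Matrix.neg_mulVec, dotProduct_neg, e4, e3] at this ⊢
    linarith

/-- Facts read off from the second matrix inequality. -/
theorem bwd_b {n m : Type*} [Fintype n] [DecidableEq n] [Fintype m] [DecidableEq m]
    {S T : Matrix n n ℝ} {C : Matrix m n ℝ} {Q : Matrix m m ℝ} (hQ : Q.PosDef)
    (hS : Sᵀ = S) (hT : Tᵀ = T)
    (h : (fromBlocks (fromBlocks (T - Cᵀ * Q * C) (1 - Cᵀ * Q * C * S) (1 - Cᵀ * Q * C * S)ᵀ S)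
      (fromRows (0 : Matrix n m ℝ) (S * Cᵀ)) (fromCols (0 : Matrix m n ℝ) (C * S)) Q⁻¹).PosDef) :
    T.PosDef ∧ (S - T⁻¹).PosDef ∧
    (∀ ζ, ζ ≠ 0 → ζ ⬝ᵥ ((C * S * Cᵀ) *ᵥ ζ) < ζ ⬝ᵥ (Q⁻¹ *ᵥ ζ)) := by
  have hK : C * S = (S * Cᵀ)ᵀ := by rw [transpose_mul, hS, transpose_transpose]
  have hQs := pd_symm hQ
  have hQu : IsUnit Q.det := (Matrix.isUnit_iff_isUnit_det _).1 hQ.isUnit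
  have hpos : ∀ a b c, (Sum.elim (Sum.elim a b) c : (n ⊕ n) ⊕ m → ℝ) ≠ 0 →
      0 < a ⬝ᵥ (T *ᵥ a) - (C *ᵥ a) ⬝ᵥ (Q *ᵥ (C *ᵥ a)) +
        2 * (a ⬝ᵥ b - (C *ᵥ a) ⬝ᵥ (Q *ᵥ (C *ᵥ (S *ᵥ b)))) + b ⬝ᵥ (S *ᵥ b) +
        2 * (c ⬝ᵥ (C *ᵥ (S *ᵥ b))) + c ⬝ᵥ (Q⁻¹ *ᵥ c) := by
    intro a b c hv
    have := pd_pos h hv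
    rw [form3 _ _ _ _ _ hK] at this
    have e1 : b ⬝ᵥ ((S * Cᵀ) *ᵥ c) = c ⬝ᵥ (C *ᵥ (S *ᵥ b)) := by
      rw [← dot_tr, ← hK, dotProduct_comm, Matrix.mulVec_mulVec]
    have e2 : a ⬝ᵥ ((T - Cᵀ * Q * C) *ᵥ a) = a ⬝ᵥ (T *ᵥ a) - (C *ᵥ a) ⬝ᵥ (Q *ᵥ (C *ᵥ a)) := by
      have := quad_congr Q Cᵀ a
      rw [transpose_transpose] at this
      rw [Matrix.sub_mulVec, dotProduct_sub, this]
    have e3 : a ⬝ᵥ ((1 - Cᵀ * Q * C * S) *ᵥ b) = a ⬝ᵥ b -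
        (C *ᵥ a) ⬝ᵥ (Q *ᵥ (C *ᵥ (S *ᵥ b))) := by
      rw [Matrix.sub_mulVec, dotProduct_sub, Matrix.one_mulVec]
      simp only [← Matrix.mulVec_mulVec]
      rw [← dot_tr, transpose_transpose]
    rw [e1, e2, e3] at this
    exact this
  have hTpd : T.PosDef := by
    refine pd_of hT fun v hv => ?_
    have := hpos v 0 0 (fun h0 => hv (by ext i; exact congrFun h0 (Sum.inl (Sum.inl i))))
    simp only [Matrix.mulVec_zero, dotProduct_zero, zero_dotProduct] at this
    have := pd_nonneg hQ (C *ᵥ v)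
    linarith
  have hTu : IsUnit T.det := (Matrix.isUnit_iff_isUnit_det _).1 hTpd.isUnit
  refine ⟨hTpd, ?_, ?_⟩
  · refine pd_of (by rw [transpose_sub, hS, pd_symm hTpd.inv]) fun v hv => ?_
    have := hpos (-(T⁻¹ *ᵥ v)) v (-(Q *ᵥ (C *ᵥ (S *ᵥ v))))
      (fun h0 => hv (by ext i; exact congrFun h0 (Sum.inl (Sum.inr i))))
    have e1 : T *ᵥ (T⁻¹ *ᵥ v) = v := by
      rw [Matrix.mulVec_mulVec, Matrix.mul_nonsing_inv _ hTu, Matrix.one_mulVec]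
    have e2 : Q⁻¹ *ᵥ (Q *ᵥ (C *ᵥ (S *ᵥ v))) = C *ᵥ (S *ᵥ v) := by
      rw [Matrix.mulVec_mulVec _ Q⁻¹, Matrix.nonsing_inv_mul _ hQu, Matrix.one_mulVec]
    have p := pd_nonneg hQ (C *ᵥ (T⁻¹ *ᵥ v) - C *ᵥ (S *ᵥ v))
    rw [Matrix.mulVec_sub, sub_dotProduct, dotProduct_sub, dotProduct_sub,
      dot_sym hQs (C *ᵥ (S *ᵥ v)) (C *ᵥ (T⁻¹ *ᵥ v))] at p
    simp only [Matrix.mulVec_neg, neg_dotProduct, dotProduct_neg, e1, e2] at this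
    rw [dotProduct_comm (T⁻¹ *ᵥ v) v, dotProduct_comm (Q *ᵥ (C *ᵥ (S *ᵥ v)))] at this
    rw [Matrix.sub_mulVec, dotProduct_sub]
    linarith
  · intro ζ hζ
    have := hpos 0 (-(Cᵀ *ᵥ ζ)) ζ (fun h0 => hζ (by ext i; exact congrFun h0 (Sum.inr i)))
    have e1 := quad_congr S C ζ
    have e2 : ζ ⬝ᵥ (C *ᵥ (S *ᵥ (Cᵀ *ᵥ ζ))) = ζ ⬝ᵥ ((C * S * Cᵀ) *ᵥ ζ) := by
      simp only [Matrix.mulVec_mulVec, Matrix.mul_assoc]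
    simp only [Matrix.mulVec_zero, dotProduct_zero, zero_dotProduct, Matrix.mulVec_neg,
      neg_dotProduct, dotProduct_neg, e2] at this
    linarith


theorem MD.blocks {ι κ l o : Type*} {P P' : ℝ → Matrix ι l ℝ} {U U' : ℝ → Matrix ι o ℝ}
    {V V' : ℝ → Matrix κ l ℝ} {Z Z' : ℝ → Matrix κ o ℝ} {a b : ℝ}
    (hP : MD P P' a b) (hU : MD U U' a b) (hV : MD V V' a b) (hZ : MD Z Z' a b) :
    MD (fun t => fromBlocks (P t) (U t) (V t) (Z t))
      (fun t => fromBlocks (P' t) (U' t) (V' t) (Z' t)) a b := by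
  intro t ht i j
  rcases i with i | i <;> rcases j with j | j
  · exact hP t ht i j
  · exact hU t ht i j
  · exact hV t ht i j
  · exact hZ t ht i j

theorem blk_form {n : Type*} [Fintype n] {X1 X2 : Matrix n n ℝ}
    (a b : n → ℝ) :
    (Sum.elim a b) ⬝ᵥ (fromBlocks X1 X1 X1 (X1 + X2) *ᵥ (Sum.elim a b)) =
      (a + b) ⬝ᵥ (X1 *ᵥ (a + b)) + b ⬝ᵥ (X2 *ᵥ b) := by
  rw [fromBlocks_mulVec, sumElim_dotProduct_sumElim]
  simp only [Sum.elim_comp_inl, Sum.elim_comp_inr, Matrix.add_mulVec, Matrix.mulVec_add,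
    dotProduct_add, add_dotProduct]
  ring

theorem blk_form' {n : Type*} [Fintype n] {X1 X2 : Matrix n n ℝ}
    (a b : n → ℝ) :
    (Sum.elim a b) ⬝ᵥ (fromBlocks (X2 + X1) X1 X1 X1 *ᵥ (Sum.elim a b)) =
      (a + b) ⬝ᵥ (X1 *ᵥ (a + b)) + a ⬝ᵥ (X2 *ᵥ a) := by
  rw [fromBlocks_mulVec, sumElim_dotProduct_sumElim]
  simp only [Sum.elim_comp_inl, Sum.elim_comp_inr, Matrix.add_mulVec, Matrix.mulVec_add,
    dotProduct_add, add_dotProduct]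
  ring

theorem elim_eta {n : Type*} (v : n ⊕ n → ℝ) : ∃ a b, v = Sum.elim a b :=
  ⟨v ∘ Sum.inl, v ∘ Sum.inr, by simp⟩

theorem backward {n q r m : Type*} [Fintype n] [DecidableEq n] [Fintype q]
    [Fintype r] [DecidableEq r] [Fintype m] [DecidableEq m] {a b : ℝ} (hab : a < b)
    {A : ℝ → Matrix n n ℝ} {B : ℝ → Matrix n q ℝ} {G : ℝ → Matrix n r ℝ}
    {C : ℝ → Matrix m n ℝ} {R : ℝ → Matrix r r ℝ} {Q : ℝ → Matrix m m ℝ}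
    (hA : Continuous A) (hB : Continuous B) (hG : Continuous G) (hC : Continuous C)
    (hR : Continuous R)
    (hRpd : ∀ t, (R t).PosDef) (hQpd : ∀ t, (Q t).PosDef)
    {S S' Tm Tm' Y0 : ℝ → Matrix n n ℝ} {hBK : ℝ → Matrix n m ℝ} {hCK : ℝ → Matrix q n ℝ}
    (hSs : ∀ t, (S t)ᵀ = S t) (hTs : ∀ t, (Tm t)ᵀ = Tm t)
    (hSc : Continuous S) (hTc : Continuous Tm)
    (hS'c : Continuous S') (hT'c : Continuous Tm')
    (hSd : MD S S' a b) (hTd : MD Tm Tm' a b)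
    (ha : ∀ t, (-(fromBlocks
            (fromBlocks
              (-(S' t) + A t * S t + S t * (A t)ᵀ + B t * hCK t + (hCK t)ᵀ * (B t)ᵀ +
                G t * (R t)⁻¹ * (G t)ᵀ)
              (Y0 t) (Y0 t)ᵀ
              (Tm' t + Tm t * A t + (A t)ᵀ * Tm t + hBK t * C t + (C t)ᵀ * (hBK t)ᵀ))
            (fromRows (0 : Matrix n r ℝ) (Tm t * G t))
            (fromCols (0 : Matrix r n ℝ) ((G t)ᵀ * Tm t))
            (-(R t)))).PosDef)
    (hb : ∀ t, (fromBlocks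
          (fromBlocks
            (Tm t - (C t)ᵀ * Q t * C t)
            (1 - (C t)ᵀ * Q t * C t * S t)
            (1 - (C t)ᵀ * Q t * C t * S t)ᵀ
            (S t))
          (fromRows (0 : Matrix n m ℝ) (S t * (C t)ᵀ))
          (fromCols (0 : Matrix m n ℝ) (C t * S t))
          ((Q t)⁻¹)).PosDef) :
    ∃ (AK : ℝ → Matrix n n ℝ) (BK : ℝ → Matrix n m ℝ) (CK : ℝ → Matrix q n ℝ)
      (DK : ℝ → Matrix q m ℝ),
      Continuous AK ∧ Continuous BK ∧ Continuous CK ∧ Continuous DK ∧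
      ∀ w : ℝ → r → ℝ,
      IntervalIntegrable (fun τ => w τ ⬝ᵥ (R τ *ᵥ w τ)) volume a b →
      (∫ τ in a..b, w τ ⬝ᵥ (R τ *ᵥ w τ)) ≤ 1 →
      ∀ x : ℝ → n ⊕ n → ℝ, Sol a b (fun τ => fromBlocks (A τ + B τ * DK τ * C τ) (B τ * CK τ)
                  (BK τ * C τ) (AK τ) *ᵥ x τ + fromRows (G τ) 0 *ᵥ w τ) x →
      ∀ t ∈ Icc a b, (fromCols (C t) 0 *ᵥ x t) ⬝ᵥ (Q t *ᵥ (fromCols (C t) 0 *ᵥ x t)) < 1 := by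
  have hRi : Continuous fun τ => (R τ)⁻¹ := cont_inv hR fun t => (hRpd t).isUnit
  have hgc : Continuous (fun t => G t * (R t)⁻¹ * (G t)ᵀ) := by fun_prop
  set g : ℝ → Matrix n n ℝ := fun t => G t * (R t)⁻¹ * (G t)ᵀ with hg
  have fa := fun t => bwd_a (hRpd t) (hSs t) (hTs t) (ha t)
  have fb := fun t => bwd_b (hQpd t) (hSs t) (hTs t) (hb t)
  obtain ⟨k1, hk1, hF1⟩ := large_mat (a := a) (b := b)
    (F := fun t => -(S' t) + A t * S t + S t * (A t)ᵀ + g t) (B := B) (by fun_prop) hB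
    (fun t _ v hv h0 => (fa t).2.2.1 v hv h0)
  obtain ⟨k2, hk2, hF2⟩ := large_mat (a := a) (b := b)
    (F := fun t => Tm' t + Tm t * A t + (A t)ᵀ * Tm t + Tm t * g t * Tm t) (B := fun t => (C t)ᵀ)
    (by fun_prop) (by fun_prop)
    (fun t _ v hv h0 => (fa t).2.2.2 v hv (by simpa using h0))
  set Y : ℝ → Matrix n n ℝ := fun t => (Tm t)⁻¹ with hY
  have hYc : Continuous Y := cont_inv hTc fun t => (fb t).1.isUnit
  set Y' : ℝ → Matrix n n ℝ := fun t => -(Y t * Tm' t * Y t) with hY'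
  have hYd : MD Y Y' a b := MD.inv hab hTd fun t _ => (fb t).1.isUnit
  have hY'c : Continuous Y' := by fun_prop
  set N : ℝ → Matrix n n ℝ := fun t => S t - Y t with hN
  have hNpd : ∀ t, (N t).PosDef := fun t => (fb t).2.1
  have hNc : Continuous N := by fun_prop
  set N' : ℝ → Matrix n n ℝ := fun t => S' t - Y' t with hN'
  have hNd : MD N N' a b := hSd.sub hYd
  have hN'c : Continuous N' := by fun_prop
  set M : ℝ → Matrix n n ℝ := fun t => (N t)⁻¹ with hM
  have hMc : Continuous M := cont_inv hNc fun t => (hNpd t).isUnit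
  set X1 : ℝ → Matrix n n ℝ := fun t =>
    -(S' t) + A t * S t + S t * (A t)ᵀ + g t - k1 • (B t * (B t)ᵀ) with hX1
  set X2 : ℝ → Matrix n n ℝ := fun t =>
    -(Y' t) + A t * Y t + Y t * (A t)ᵀ + g t - k2 • (Y t * (C t)ᵀ * C t * Y t) with hX2
  have hX1c : Continuous X1 := by fun_prop
  set K : ℝ → Matrix q n ℝ := fun t => (-(k1 / 2)) • ((B t)ᵀ * M t) with hK
  set L : ℝ → Matrix n m ℝ := fun t => (k2 / 2) • (Y t * (C t)ᵀ) with hL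
  have hKc : Continuous K := by fun_prop
  have hLc : Continuous L := by fun_prop
  set AK : ℝ → Matrix n n ℝ := fun t =>
    (X1 t + N' t - A t * N t - B t * K t * N t - S t * (C t)ᵀ * (L t)ᵀ)ᵀ * M t with hAK
  have hAKc : Continuous AK := by fun_prop
  have hYs : ∀ t, (Y t)ᵀ = Y t := fun t => pd_symm (fb t).1.inv
  have hYT : ∀ t, Y t * Tm t = 1 := fun t =>
    Matrix.nonsing_inv_mul _ ((Matrix.isUnit_iff_isUnit_det _).1 (fb t).1.isUnit)
  have hTY : ∀ t, Tm t * Y t = 1 := fun t =>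
    Matrix.mul_nonsing_inv _ ((Matrix.isUnit_iff_isUnit_det _).1 (fb t).1.isUnit)
  have hY's : ∀ t, (Y' t)ᵀ = Y' t := by
    intro t
    simp only [hY', transpose_neg, transpose_mul, hYs, (fa t).2.1, Matrix.mul_assoc]
  have hgs : ∀ t, (g t)ᵀ = g t := fun t => sym_GRG (hRpd t) _
  have eqn : ∀ t, _ := fun t => bwd_alg (A := A t) (B := B t) (C := C t) (hSs t) (fa t).1 (hYs t)
    (hY's t) (hgs t) (pd_symm (hNpd t).inv) (N := N t) rfl (N' := N' t) rfl
    (Matrix.nonsing_inv_mul _ ((Matrix.isUnit_iff_isUnit_det _).1 (hNpd t).isUnit))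
    (Matrix.mul_nonsing_inv _ ((Matrix.isUnit_iff_isUnit_det _).1 (hNpd t).isUnit))
    (X1 := X1 t) (k1 := k1) rfl (X2 := X2 t) (k2 := k2) rfl (K := K t) rfl (L := L t) rfl
    (AK := AK t) rfl
  have hX1n : ∀ t ∈ Icc a b, ∀ v, v ⬝ᵥ (X1 t *ᵥ v) ≤ 0 := by
    intro t ht v
    by_cases hv : v = 0
    · simp [hv]
    have := hF1 t ht v hv
    simp only [hX1]
    rw [Matrix.sub_mulVec, dotProduct_sub, Matrix.smul_mulVec, dotProduct_smul, smul_eq_mul]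
    linarith
  have hX2n : ∀ t ∈ Icc a b, ∀ v, v ⬝ᵥ (X2 t *ᵥ v) ≤ 0 := by
    intro t ht v
    by_cases hv : v = 0
    · simp [hv]
    have hYv : Y t *ᵥ v ≠ 0 := by
      intro h0
      apply hv
      have := congrArg (fun u => Tm t *ᵥ u) h0
      simpa [Matrix.mulVec_mulVec, hTY] using this
    have := hF2 t ht (Y t *ᵥ v) hYv
    have e : X2 t = Y t * ((Tm' t + Tm t * A t + (A t)ᵀ * Tm t + Tm t * g t * Tm t) -
        k2 • ((C t)ᵀ * ((C t)ᵀ)ᵀ)) * (Y t)ᵀ := by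
      rw [hYs, transpose_transpose]
      have e1 : Y t * (Tm t * A t) * Y t = A t * Y t := by
        rw [← Matrix.mul_assoc, hYT, Matrix.one_mul]
      have e2 : Y t * ((A t)ᵀ * Tm t) * Y t = Y t * (A t)ᵀ := by
        rw [Matrix.mul_assoc, Matrix.mul_assoc, hTY, Matrix.mul_one]
      have e3 : Y t * (Tm t * g t * Tm t) * Y t = g t := by
        rw [Matrix.mul_assoc, Matrix.mul_assoc (_ * _), hTY, Matrix.mul_one, ← Matrix.mul_assoc,
          hYT, Matrix.one_mul]
      have e4 : Y t * (k2 • ((C t)ᵀ * C t)) * Y t = k2 • (Y t * (C t)ᵀ * C t * Y t) := by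
        rw [Matrix.mul_smul, Matrix.smul_mul, ← Matrix.mul_assoc]
      rw [Matrix.mul_sub, Matrix.sub_mul, e4, Matrix.mul_add, Matrix.mul_add, Matrix.mul_add,
        Matrix.add_mul, Matrix.add_mul, Matrix.add_mul, e1, e2, e3]
      simp only [hX2, hY', neg_neg]
    rw [e, quad_congr, hYs, Matrix.sub_mulVec, dotProduct_sub, Matrix.smul_mulVec,
      dotProduct_smul, smul_eq_mul]
    linarith
  refine ⟨AK, L, K, fun _ => 0, hAKc, hLc, hKc, continuous_const, fun w hw hw1 x hx t ht => ?_⟩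
  have hx2 : Sol a b (fun τ => fromBlocks (A τ) (B τ * K τ) (L τ * C τ) (AK τ) *ᵥ x τ +
      fromRows (G τ) 0 *ᵥ w τ) x := by
    refine hx.congr fun τ _ => ?_
    simp
  have hWd : MD (fun t => fromBlocks (S t) (N t) (N t) (N t))
    (fun t => fromBlocks (S' t) (N' t) (N' t) (N' t)) a b := hSd.blocks hNd hNd hNd
  have hW'c : Continuous (fun t => fromBlocks (S' t) (N' t) (N' t) (N' t)) :=
    hS'c.matrix_fromBlocks hN'c hN'c hN'c
  have hAcl : Continuous (fun τ => fromBlocks (A τ) (B τ * K τ) (L τ * C τ) (AK τ)) :=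
    hA.matrix_fromBlocks (by fun_prop) (by fun_prop) hAKc
  set y := fromCols (C t) (0 : Matrix m n ℝ) *ᵥ x t with hy
  have en := energy hab.le hAcl (fun t _ => hRpd t) hWd
    (fun i j => (hW'c.matrix_elem i j).continuousOn)
    (fun v => by
      obtain ⟨c, d, rfl⟩ := elim_eta v
      have : S a = Y a + N a := by simp only [hN]; abel
      simp only [this]
      rw [blk_form']
      exact add_nonneg (pd_nonneg (hNpd a) _) (pd_nonneg (fb a).1.inv _))
    (fun t ht v => by
      obtain ⟨c, d, rfl⟩ := elim_eta v
      have e : fromBlocks (S' t) (N' t) (N' t) (N' t) -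
          fromBlocks (A t) (B t * K t) (L t * C t) (AK t) * fromBlocks (S t) (N t) (N t) (N t) -
          fromBlocks (S t) (N t) (N t) (N t) *
            (fromBlocks (A t) (B t * K t) (L t * C t) (AK t))ᵀ =
          fromBlocks (g t) 0 0 0 - fromBlocks (X1 t) (X1 t) (X1 t) (X1 t + X2 t) := by
        rw [eqn t, ← fromBlocks_neg]; abel
      rw [e, gcl, Matrix.sub_mulVec, dotProduct_sub, blk_form]
      have h1 := hX1n t ht (c + d)
      have h2 := hX2n t ht d
      simp only [hg]
      linarith)
    hw hw1 hx2 ht ((fromCols (C t) (0 : Matrix m n ℝ))ᵀ *ᵥ (Q t *ᵥ y))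
  rw [dot_tr, ← hy, ← quad_congr] at en
  have eC : fromCols (C t) (0 : Matrix m n ℝ) * fromBlocks (S t) (N t) (N t) (N t) *
      (fromCols (C t) (0 : Matrix m n ℝ))ᵀ = C t * S t * (C t)ᵀ := by
    rw [fromCols_mul_fromBlocks, transpose_fromCols, fromCols_mul_fromRows]
    simp
  rw [eC] at en
  by_cases hy0 : y = 0
  · rw [hy0]; simp
  have hQu : IsUnit (Q t).det := (Matrix.isUnit_iff_isUnit_det _).1 (hQpd t).isUnit
  have e5 : (Q t)⁻¹ *ᵥ (Q t *ᵥ y) = y := by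
    rw [Matrix.mulVec_mulVec, Matrix.nonsing_inv_mul _ hQu, Matrix.one_mulVec]
  have := (fb t).2.2 (Q t *ᵥ y) (fun h0 => hy0 (by rw [← e5, h0, Matrix.mulVec_zero]))
  rw [e5] at this
  rw [dotProduct_comm]
  linarith

/-- **IO finite-time stabilization via dynamic output feedback (necessary and sufficient).**
For the plant `ẋ = A x + B u + G w`, `x(t₀) = 0`, `y = C x` on `Ω = [t₀, t₀+T]`, there
exists a dynamic output-feedback controller `ẋ_c = A_K x_c + B_K y`, `u = C_K x_c + D_K y`
making the closed loop IO-FTS w.r.t. `(W₂, Q(·), Ω)` if and only if there exist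
continuously differentiable symmetric `S(·)`, `T(·)`, a nonsingular `N(·)` and
`Â_K, B̂_K, Ĉ_K, D_K` satisfying the two coupled DLMIs (a) and (b). -/
theorem io_finite_time_stabilization_output_feedback_iff
    {n q r m : ℕ} (t₀ T : ℝ) (hT : 0 < T)
    (A : ℝ → Matrix (Fin n) (Fin n) ℝ)
    (B : ℝ → Matrix (Fin n) (Fin q) ℝ)
    (G : ℝ → Matrix (Fin n) (Fin r) ℝ)
    (C : ℝ → Matrix (Fin m) (Fin n) ℝ)
    (R : ℝ → Matrix (Fin r) (Fin r) ℝ)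
    (Q : ℝ → Matrix (Fin m) (Fin m) ℝ)
    (hA : ∀ i j, ContinuousOn (fun t => A t i j) (Icc t₀ (t₀ + T)))
    (hB : ∀ i j, ContinuousOn (fun t => B t i j) (Icc t₀ (t₀ + T)))
    (hG : ∀ i j, ContinuousOn (fun t => G t i j) (Icc t₀ (t₀ + T)))
    (hC : ∀ i j, ContinuousOn (fun t => C t i j) (Icc t₀ (t₀ + T)))
    (hR : ∀ i j, ContinuousOn (fun t => R t i j) (Icc t₀ (t₀ + T)))
    (hQ : ∀ i j, ContinuousOn (fun t => Q t i j) (Icc t₀ (t₀ + T)))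
    (hRpd : ∀ t ∈ Icc t₀ (t₀ + T), (R t).PosDef)
    (hQpd : ∀ t ∈ Icc t₀ (t₀ + T), (Q t).PosDef) :
    -- LHS: there exists a dynamic output feedback controller making the closed loop IO-FTS
    (∃ (AK : ℝ → Matrix (Fin n) (Fin n) ℝ) (BK : ℝ → Matrix (Fin n) (Fin m) ℝ)
       (CK : ℝ → Matrix (Fin q) (Fin n) ℝ) (DK : ℝ → Matrix (Fin q) (Fin m) ℝ),
      (∀ i j, ContinuousOn (fun t => AK t i j) (Icc t₀ (t₀ + T))) ∧
      (∀ i j, ContinuousOn (fun t => BK t i j) (Icc t₀ (t₀ + T))) ∧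
      (∀ i j, ContinuousOn (fun t => CK t i j) (Icc t₀ (t₀ + T))) ∧
      (∀ i j, ContinuousOn (fun t => DK t i j) (Icc t₀ (t₀ + T))) ∧
      -- the closed loop, with state `(x, x_c)`, dynamics `A_CL = [[A + B D_K C, B C_K],
      -- [B_K C, A_K]]`, input matrix `G_CL = [Gᵀ 0]ᵀ` and output `y = [C 0] (x, x_c)`,
      -- is IO-FTS w.r.t. `(W₂, Q(·), Ω)`
      (∀ w : ℝ → Fin r → ℝ, Measurable w →
        IntervalIntegrable (fun τ => w τ ⬝ᵥ (R τ *ᵥ w τ)) volume t₀ (t₀ + T) →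
        (∫ τ in t₀..(t₀ + T), w τ ⬝ᵥ (R τ *ᵥ w τ)) ≤ 1 →
        ∀ xCL : ℝ → (Fin n ⊕ Fin n) → ℝ,
          (∀ t ∈ Icc t₀ (t₀ + T),
            IntervalIntegrable
              (fun τ => Matrix.fromBlocks (A τ + B τ * DK τ * C τ) (B τ * CK τ)
                  (BK τ * C τ) (AK τ) *ᵥ xCL τ + Matrix.fromRows (G τ) 0 *ᵥ w τ)
              volume t₀ t ∧
            xCL t = ∫ τ in t₀..t,
              (Matrix.fromBlocks (A τ + B τ * DK τ * C τ) (B τ * CK τ)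
                  (BK τ * C τ) (AK τ) *ᵥ xCL τ + Matrix.fromRows (G τ) 0 *ᵥ w τ)) →
          ∀ t ∈ Icc t₀ (t₀ + T),
            (Matrix.fromCols (C t) 0 *ᵥ xCL t) ⬝ᵥ
              (Q t *ᵥ (Matrix.fromCols (C t) 0 *ᵥ xCL t)) < 1))
    ↔
    -- RHS: feasibility of the coupled DLMIs
    (∃ (S S' Tm Tm' : ℝ → Matrix (Fin n) (Fin n) ℝ)
       (N : ℝ → Matrix (Fin n) (Fin n) ℝ)
       (hAK : ℝ → Matrix (Fin n) (Fin n) ℝ) (hBK : ℝ → Matrix (Fin n) (Fin m) ℝ)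
       (hCK : ℝ → Matrix (Fin q) (Fin n) ℝ) (DK : ℝ → Matrix (Fin q) (Fin m) ℝ),
      -- `S`, `T` continuously differentiable and symmetric
      (∀ t ∈ Icc t₀ (t₀ + T), (S t).IsHermitian ∧ (Tm t).IsHermitian) ∧
      (∀ i j, ContinuousOn (fun t => S' t i j) (Icc t₀ (t₀ + T))) ∧
      (∀ i j, ContinuousOn (fun t => Tm' t i j) (Icc t₀ (t₀ + T))) ∧
      (∀ t ∈ Icc t₀ (t₀ + T), ∀ i j,
        HasDerivWithinAt (fun s => S s i j) (S' t i j) (Icc t₀ (t₀ + T)) t) ∧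
      (∀ t ∈ Icc t₀ (t₀ + T), ∀ i j,
        HasDerivWithinAt (fun s => Tm s i j) (Tm' t i j) (Icc t₀ (t₀ + T)) t) ∧
      -- `N` nonsingular
      (∀ t ∈ Icc t₀ (t₀ + T), IsUnit (N t)) ∧
      -- (a): `[[Θ₁₁, Θ₁₂, 0], [Θ₁₂ᵀ, Θ₂₂, T G], [0, Gᵀ T, −R]] < 0`
      (∀ t ∈ Icc t₀ (t₀ + T),
        (-(Matrix.fromBlocks
            (Matrix.fromBlocks
              (-(S' t) + A t * S t + S t * (A t)ᵀ + B t * hCK t + (hCK t)ᵀ * (B t)ᵀ +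
                G t * (R t)⁻¹ * (G t)ᵀ)                                  -- Θ₁₁
              (A t + (hAK t)ᵀ + B t * DK t * C t + G t * (R t)⁻¹ * (G t)ᵀ * Tm t)  -- Θ₁₂
              (A t + (hAK t)ᵀ + B t * DK t * C t + G t * (R t)⁻¹ * (G t)ᵀ * Tm t)ᵀ
              (Tm' t + Tm t * A t + (A t)ᵀ * Tm t + hBK t * C t + (C t)ᵀ * (hBK t)ᵀ))  -- Θ₂₂
            (Matrix.fromRows (0 : Matrix (Fin n) (Fin r) ℝ) (Tm t * G t))
            (Matrix.fromCols (0 : Matrix (Fin r) (Fin n) ℝ) ((G t)ᵀ * Tm t))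
            (-(R t)))).PosDef) ∧
      -- (b): `[[Ξ₁₁, Ξ₁₂, 0], [Ξ₁₂ᵀ, S, S Cᵀ], [0, C S, Q⁻¹]] > 0`
      (∀ t ∈ Icc t₀ (t₀ + T),
        (Matrix.fromBlocks
          (Matrix.fromBlocks
            (Tm t - (C t)ᵀ * Q t * C t)                                  -- Ξ₁₁
            (1 - (C t)ᵀ * Q t * C t * S t)                               -- Ξ₁₂
            (1 - (C t)ᵀ * Q t * C t * S t)ᵀ
            (S t))
          (Matrix.fromRows (0 : Matrix (Fin n) (Fin m) ℝ) (S t * (C t)ᵀ))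
          (Matrix.fromCols (0 : Matrix (Fin m) (Fin n) ℝ) (C t * S t))
          ((Q t)⁻¹)).PosDef)) := by
  have hlt : t₀ < t₀ + T := by linarith
  have hle := hlt.le
  generalize hbdef : t₀ + T = b at *
  clear hbdef
  have mem := clampI_mem hle
  have wcongr : ∀ w : ℝ → Fin r → ℝ, ∀ τ ∈ Icc t₀ b,
      w τ ⬝ᵥ (R τ *ᵥ w τ) = w τ ⬝ᵥ (R (clampI t₀ b τ) *ᵥ w τ) := by
    intro w τ hτ
    rw [clampI_eq hτ]
  have wi : ∀ w : ℝ → Fin r → ℝ,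
      (IntervalIntegrable (fun τ => w τ ⬝ᵥ (R τ *ᵥ w τ)) volume t₀ b ↔
        IntervalIntegrable (fun τ => w τ ⬝ᵥ (R (clampI t₀ b τ) *ᵥ w τ)) volume t₀ b) := by
    intro w
    constructor <;> intro h <;> refine h.congr fun τ hτ => ?_
    · exact wcongr w τ (by rw [← uIcc_of_le hle]; exact uIoc_subset_uIcc hτ)
    · exact (wcongr w τ (by rw [← uIcc_of_le hle]; exact uIoc_subset_uIcc hτ)).symm
  have we : ∀ w : ℝ → Fin r → ℝ, (∫ τ in t₀..b, w τ ⬝ᵥ (R τ *ᵥ w τ)) =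
      ∫ τ in t₀..b, w τ ⬝ᵥ (R (clampI t₀ b τ) *ᵥ w τ) := by
    intro w
    refine intervalIntegral.integral_congr fun τ hτ => ?_
    rw [uIcc_of_le hle] at hτ
    exact wcongr w τ hτ
  constructor
  · rintro ⟨AK, BK, CK, DK, hAKc, hBKc, hCKc, hDKc, hio⟩
    obtain ⟨S, S', Tm, Tm', hAK, hBK, hCK, hs, hS', hT', hSd, hTd, ha, hb⟩ :=
      forward hlt (cont_clamp hle hA) (cont_clamp hle hB) (cont_clamp hle hG) (cont_clamp hle hC)
        (cont_clamp hle hR) (cont_clamp hle hQ) (fun t => hRpd _ (mem t)) (fun t => hQpd _ (mem t))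
        (cont_clamp hle hAKc) (cont_clamp hle hBKc) (cont_clamp hle hCKc) (cont_clamp hle hDKc)
        (fun w hw h1 h2 x hx t ht => by
          have hx2 : Sol t₀ b (fun τ => fromBlocks (A τ + B τ * DK τ * C τ) (B τ * CK τ)
                  (BK τ * C τ) (AK τ) *ᵥ x τ + fromRows (G τ) 0 *ᵥ w τ) x :=
            hx.congr fun τ hτ => by simp only [clampI_eq hτ]
          have := hio w hw ((wi w).2 h1) (by rw [we]; exact h2) x hx2 t ht
          simpa only [clampI_eq ht] using this)
    refine ⟨S, S', Tm, Tm', fun _ => 1, hAK, hBK, hCK, DK, ?_, hS', hT', hSd, hTd,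
      fun _ _ => isUnit_one, ?_, ?_⟩
    · intro t ht
      exact ⟨by rw [Matrix.IsHermitian, conjTranspose_eq_transpose_of_trivial]; exact (hs t ht).1,
        by rw [Matrix.IsHermitian, conjTranspose_eq_transpose_of_trivial]; exact (hs t ht).2⟩
    · intro t ht
      have := ha t ht
      simpa only [clampI_eq ht] using this
    · intro t ht
      have := hb t ht
      simpa only [clampI_eq ht] using this
  · rintro ⟨S, S', Tm, Tm', -, hAK, hBK, hCK, DK, hs, hS', hT', hSd, hTd, -, ha, hb⟩
    have hSd2 : MD S S' t₀ b := hSd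
    have hTd2 : MD Tm Tm' t₀ b := hTd
    have sy : ∀ {M : Matrix (Fin n) (Fin n) ℝ}, M.IsHermitian → Mᵀ = M := by
      intro M h
      rw [← conjTranspose_eq_transpose_of_trivial]; exact h
    obtain ⟨AK, BK, CK, DK', h1, h2, h3, h4, hio⟩ :=
      backward hlt (cont_clamp hle hA) (cont_clamp hle hB) (cont_clamp hle hG) (cont_clamp hle hC)
        (cont_clamp hle hR) (fun t => hRpd _ (mem t)) (fun t => hQpd _ (mem t))
        (fun t => sy (hs _ (mem t)).1) (fun t => sy (hs _ (mem t)).2)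
        (cont_clamp hle hSd2.contOn) (cont_clamp hle hTd2.contOn)
        (cont_clamp hle hS') (cont_clamp hle hT')
        (hSd2.congr (fun t ht => by rw [clampI_eq ht]) (fun t ht => by rw [clampI_eq ht]))
        (hTd2.congr (fun t ht => by rw [clampI_eq ht]) (fun t ht => by rw [clampI_eq ht]))
        (Y0 := fun t => A (clampI t₀ b t) + (hAK (clampI t₀ b t))ᵀ +
          B (clampI t₀ b t) * DK (clampI t₀ b t) * C (clampI t₀ b t) +
          G (clampI t₀ b t) * (R (clampI t₀ b t))⁻¹ * (G (clampI t₀ b t))ᵀ * Tm (clampI t₀ b t))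
        (hBK := fun t => hBK (clampI t₀ b t)) (hCK := fun t => hCK (clampI t₀ b t))
        (fun t => ha _ (mem t)) (fun t => hb _ (mem t))
    refine ⟨AK, BK, CK, DK', fun i j => (h1.matrix_elem i j).continuousOn,
      fun i j => (h2.matrix_elem i j).continuousOn, fun i j => (h3.matrix_elem i j).continuousOn,
      fun i j => (h4.matrix_elem i j).continuousOn, ?_⟩
    intro w _ hw1 hw2 x hx t ht
    have hx1 : Sol t₀ b (fun τ => fromBlocks (A τ + B τ * DK' τ * C τ) (B τ * CK τ)
                  (BK τ * C τ) (AK τ) *ᵥ x τ + fromRows (G τ) 0 *ᵥ w τ) x := hx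
    have := hio w ((wi w).1 hw1) (by rw [← we]; exact hw2) x
      (hx1.congr fun τ hτ => by simp only [clampI_eq hτ]) t ht
    simpa only [clampI_eq ht] using this
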